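/- arXiv:2501.11157 — 4 statements merged into one kernel-verified Lean document; each statement's English description precedes it below -/
import Mathlib

section
/- The thinness of any tree on n vertices is at most log base 3 of (n + 2). -/
open SimpleGraph

variable {V : Type*}

def Consistent (G : SimpleGraph V) (r : V → V → Prop) {k : ℕ} (C : V → Fin k) : Prop :=
  ∀ u v w, r u v → r v w → C u = C v → G.Adj u w → G.Adj v w

def IsKThin (G : SimpleGraph V) (k : ℕ) : Prop :=
  ∃ r : V → V → Prop, IsStrictTotalOrder V r ∧ ∃ C : V → Fin k, Consistent G r C

noncomputable def Thinness (G : SimpleGraph V) : ℕ := sInf {k | IsKThin G k}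

noncomputable def DanglingThin (G : SimpleGraph V) (v u : V) : ℕ :=
  Thinness (G.induce ((G.deleteEdges {s(v,u)}).connectedComponentMk u).supp)

def KNeighbor (G : SimpleGraph V) (k : ℕ) (x v : V) : Prop :=
  G.Adj x v ∧ ∃ u, G.Adj v u ∧ u ≠ x ∧ k ≤ DanglingThin G v u

def IsChild (G : SimpleGraph V) (rt x v : V) : Prop :=
  G.Adj x v ∧ G.dist rt x + 1 = G.dist rt v

def IsAncestor (G : SimpleGraph V) (rt v x : V) : Prop :=
  v ≠ x ∧ G.dist rt v + G.dist v x = G.dist rt x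

def Subtree (G : SimpleGraph V) (rt v : V) : Set V :=
  {w | G.dist rt v + G.dist v w = G.dist rt w}

def ChildKNeighbor (G : SimpleGraph V) (rt : V) (k : ℕ) (x v : V) : Prop :=
  IsChild G rt x v ∧ KNeighbor G k x v

noncomputable def Critical (G : SimpleGraph V) (rt x : V) : Prop :=
  {v | ChildKNeighbor G rt (Thinness G) x v}.ncard = 2


/-- The branch hanging from the directed edge `y → x` of a tree. -/
def Br (G : SimpleGraph V) (y x : V) : Set V := {w | G.dist y w = G.dist x w + 1}

lemma closer_exists {G : SimpleGraph V} (hT : G.IsTree) {x w : V} (h : w ≠ x) :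
    ∃ v, G.Adj x v ∧ w ∈ Br G x v := by
  obtain ⟨p, hp⟩ := hT.connected.exists_walk_length_eq_dist x w
  cases p with
  | nil => exact absurd rfl h
  | @cons _ v _ hadj q =>
    refine ⟨v, hadj, ?_⟩
    have h1 := dist_le q
    have h2 := hT.connected.dist_triangle (u := x) (v := v) (w := w)
    have h3 : G.dist x v = 1 := dist_eq_one_iff_adj.2 hadj
    simp only [Walk.length_cons] at hp
    simp only [Br, Set.mem_ofPred_eq]
    omega

lemma closer_unique {G : SimpleGraph V} (hT : G.IsTree) {x w v v' : V}
    (hv : G.Adj x v) (hv' : G.Adj x v') (h : w ∈ Br G x v) (h' : w ∈ Br G x v') : v = v' := by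
  simp only [Br, Set.mem_ofPred_eq] at h h'
  obtain ⟨p, hp⟩ := hT.connected.exists_walk_length_eq_dist v w
  obtain ⟨q, hq⟩ := hT.connected.exists_walk_length_eq_dist v' w
  have h1 : (Walk.cons hv p).IsPath := Walk.isPath_of_length_eq_dist _ (by simp; omega)
  have h2 : (Walk.cons hv' q).IsPath := Walk.isPath_of_length_eq_dist _ (by simp; omega)
  have := (hT.existsUnique_path x w).unique h1 h2
  simp only [Walk.cons.injEq] at this
  exact this.1

lemma br_dichotomy {G : SimpleGraph V} (hT : G.IsTree) {x y : V} (h : G.Adj x y) (w : V) :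
    w ∉ Br G x y ↔ w ∈ Br G y x := by
  have := hT.dist_eq_dist_add_one_of_adj w h
  simp only [Br, Set.mem_ofPred_eq]
  rw [G.dist_comm (u := x), G.dist_comm (u := y)]
  omega

lemma br_self {G : SimpleGraph V} {x y : V} (h : G.Adj y x) : x ∈ Br G y x := by
  simp [Br, dist_eq_one_iff_adj.2 h]

lemma not_mem_br {G : SimpleGraph V} {x y : V} : x ∉ Br G x y := by
  simp [Br]

lemma br_edge {G : SimpleGraph V} (hT : G.IsTree) {x v a b : V} (h : G.Adj x v)
    (ha : a ∈ Br G x v) (hb : b ∉ Br G x v) (hab : G.Adj a b) : a = v ∧ b = x := by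
  rw [br_dichotomy hT h] at hb
  simp only [Br, Set.mem_ofPred_eq] at ha hb
  have e1 := hT.dist_eq_dist_add_one_of_adj v hab
  have e2 := hT.dist_eq_dist_add_one_of_adj x hab
  by_cases hav : a = v
  · subst hav
    have hs : G.dist a a = 0 := dist_self
    refine ⟨rfl, ?_⟩
    have : G.dist x b = 0 := by omega
    exact ((hT.connected.dist_eq_zero_iff).1 this).symm
  · exfalso
    obtain ⟨c, hac, hc⟩ := closer_exists hT (x := a) (w := v) (Ne.symm hav)
    simp only [Br, Set.mem_ofPred_eq] at hc
    rw [G.dist_comm (v := v), G.dist_comm (v := v)] at hc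
    have e3 := hT.dist_eq_dist_add_one_of_adj x hac
    have e4 := hT.connected.dist_triangle (u := x) (v := v) (w := c)
    have h3 : G.dist x v = 1 := dist_eq_one_iff_adj.2 h
    have : b = c := by
      apply closer_unique hT hab hac (w := x) <;>
      · simp only [Br, Set.mem_ofPred_eq]
        rw [G.dist_comm (v := x), G.dist_comm (v := x)]
        omega
    subst this
    omega

lemma br_sub {G : SimpleGraph V} (hT : G.IsTree) {x y v : V} (hy : G.Adj y x) (hv : G.Adj x v)
    (hne : v ≠ y) : Br G x v ⊆ Br G y x := by
  intro w hw
  by_contra h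
  rw [br_dichotomy hT hy] at h
  exact hne (closer_unique hT hv hy.symm hw h)

lemma br_decomp {G : SimpleGraph V} (hT : G.IsTree) {x y : V} (hy : G.Adj y x) (w : V) :
    w ∈ Br G y x ↔ w = x ∨ ∃ v, (G.Adj x v ∧ v ≠ y) ∧ w ∈ Br G x v := by
  constructor
  · intro h
    by_cases hw : w = x
    · exact Or.inl hw
    · obtain ⟨v, hv, hwv⟩ := closer_exists hT hw
      refine Or.inr ⟨v, ⟨hv, ?_⟩, hwv⟩
      rintro rfl
      exact (br_dichotomy hT hv w).2 h hwv
  · rintro (rfl | ⟨v, ⟨hv, hne⟩, hw⟩)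
    · exact br_self hy
    · exact br_sub hT hy hv hne hw

lemma br_disjoint {G : SimpleGraph V} (hT : G.IsTree) {x v v' : V} (hv : G.Adj x v)
    (hv' : G.Adj x v') (hne : v ≠ v') : Disjoint (Br G x v) (Br G x v') :=
  Set.disjoint_left.2 fun _ h h' => hne (closer_unique hT hv hv' h h')

lemma br_no_edge {G : SimpleGraph V} (hT : G.IsTree) {x v v' a b : V} (hv : G.Adj x v)
    (hv' : G.Adj x v') (hne : v ≠ v') (ha : a ∈ Br G x v) (hb : b ∈ Br G x v') :
    ¬ G.Adj a b := by
  intro hab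
  have := (br_edge hT hv ha (Set.disjoint_right.1 (br_disjoint hT hv hv' hne) hb) hab).2
  subst this
  exact not_mem_br hb

lemma br_adj_root {G : SimpleGraph V} (hT : G.IsTree) {x v a : V} (hv : G.Adj x v)
    (ha : a ∈ Br G x v) : G.Adj a x ↔ a = v := by
  constructor
  · intro h
    exact (br_edge hT hv ha not_mem_br h).1
  · rintro rfl
    exact hv.symm

lemma br_tree {G : SimpleGraph V} (hT : G.IsTree) {x v : V} (hv : G.Adj x v) :
    (G.induce (Br G x v)).IsTree := by
  refine ⟨?_, hT.isAcyclic.induce _⟩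
  have key : ∀ n : ℕ, ∀ w : V, ∀ hw : w ∈ Br G x v, G.dist v w = n →
      (G.induce (Br G x v)).Reachable ⟨w, hw⟩ ⟨v, br_self hv⟩ := by
    intro n
    induction n with
    | zero =>
      intro w hw h
      have := (hT.connected.dist_eq_zero_iff).1 h
      subst this
      exact Reachable.refl _
    | succ n ih =>
      intro w hw h
      have hne : v ≠ w := by rintro rfl; simp at h
      obtain ⟨c, hc, hc'⟩ := closer_exists hT hne
      simp only [Br, Set.mem_ofPred_eq] at hc'
      rw [G.dist_comm (v := v), G.dist_comm (v := v)] at hc'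
      have hcB : c ∈ Br G x v := by
        by_contra hcon
        exact hne.symm (br_edge hT hv hw hcon hc).1
      refine Reachable.trans ?_ (ih c hcB (by omega))
      apply Adj.reachable
      simpa using hc
  have : Nonempty (Br G x v) := ⟨⟨v, br_self hv⟩⟩
  refine Connected.mk fun a b => ?_
  exact (key _ a.1 a.2 rfl).trans (key _ b.1 b.2 rfl).symm

/-- Consistency of a list of pairs (vertex, class). -/
def Cons (G : SimpleGraph V) (L : List (V × ℕ)) : Prop :=
  ∀ a b c, List.Sublist [a, b, c] L → a.2 = b.2 → G.Adj a.1 c.1 → G.Adj b.1 c.1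

/-- `L` is a consistent layout of the vertex set `A` whose entries satisfy `Q`. -/
structure Lay (G : SimpleGraph V) (Q : V × ℕ → Prop) (A : Set V) (L : List (V × ℕ)) : Prop where
  nodup : (L.map Prod.fst).Nodup
  mem : ∀ w, w ∈ L.map Prod.fst ↔ w ∈ A
  q : ∀ p ∈ L, Q p
  cons : Cons G L

lemma Lay.memA {G : SimpleGraph V} {Q : V × ℕ → Prop} {A : Set V} {L : List (V × ℕ)}
    (h : Lay G Q A L) {p : V × ℕ} (hp : p ∈ L) : p.1 ∈ A :=
  (h.mem _).1 (List.mem_map_of_mem hp)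

lemma Lay.mono {G : SimpleGraph V} {Q Q' : V × ℕ → Prop} {A A' : Set V} {L : List (V × ℕ)}
    (h : Lay G Q A L) (hA : A = A') (hQ : ∀ p : V × ℕ, p.1 ∈ A → Q p → Q' p) : Lay G Q' A' L := by
  subst hA
  exact ⟨h.nodup, h.mem, fun p hp => hQ p (h.memA hp) (h.q p hp), h.cons⟩

lemma Lay.nil {G : SimpleGraph V} {Q : V × ℕ → Prop} : Lay G Q ∅ [] :=
  ⟨by simp, by simp, by simp, by intro a b c h; simp at h⟩

lemma cons_append {G : SimpleGraph V} {L M : List (V × ℕ)} (hL : Cons G L) (hM : Cons G M)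
    (h : ∀ a ∈ L, ∀ b ∈ M, ¬ G.Adj a.1 b.1) : Cons G (L ++ M) := by
  intro a b c hs hab hac
  rw [List.sublist_append_iff] at hs
  obtain ⟨l₁, l₂, he, h1, h2⟩ := hs
  have hc : c ∈ l₂ → a ∈ l₁ → False := fun hc ha => h a (h1.subset ha) c (h2.subset hc) hac
  rcases l₁ with _ | ⟨a', _ | ⟨b', _ | ⟨c', _ | ⟨d', t⟩⟩⟩⟩
  · simp at he; subst he; exact hM a b c h2 hab hac
  · simp at he; obtain ⟨rfl, rfl⟩ := he; exact (hc (by simp) (by simp)).elim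
  · simp at he; obtain ⟨rfl, rfl, rfl⟩ := he; exact (hc (by simp) (by simp)).elim
  · simp at he; obtain ⟨rfl, rfl, rfl, rfl⟩ := he; exact hL _ _ _ h1 hab hac
  · simp at he

lemma cons_snoc {G : SimpleGraph V} {L : List (V × ℕ)} {x : V × ℕ} (hL : Cons G L)
    (h : ∀ a b, List.Sublist [a, b] L → a.2 = b.2 → G.Adj a.1 x.1 → G.Adj b.1 x.1) :
    Cons G (L ++ [x]) := by
  intro a b c hs hab hac
  rw [List.sublist_append_iff] at hs
  obtain ⟨l₁, l₂, he, h1, h2⟩ := hs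
  rw [List.sublist_singleton] at h2
  rcases h2 with rfl | rfl
  · simp at he; subst he; exact hL a b c h1 hab hac
  · have he' : [a, b] ++ [c] = l₁ ++ [x] := by simpa using he
    obtain ⟨rfl, he2⟩ := List.append_inj' he' rfl
    simp at he2; subst he2
    exact h a b h1 hab hac

lemma cons_cons {G : SimpleGraph V} {L : List (V × ℕ)} {x : V × ℕ} (hL : Cons G L)
    (h : ∀ p ∈ L, p.2 ≠ x.2) : Cons G (x :: L) := by
  intro a b c hs hab hac
  rw [List.sublist_cons_iff] at hs
  rcases hs with hs | ⟨r, he, hr⟩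
  · exact hL a b c hs hab hac
  · simp at he
    obtain ⟨rfl, rfl⟩ := he
    exact absurd hab.symm (h b (hr.subset (by simp)))

lemma Lay.append {G : SimpleGraph V} {Q : V × ℕ → Prop} {A B : Set V} {L M : List (V × ℕ)}
    (hL : Lay G Q A L) (hM : Lay G Q B M) (hd : Disjoint A B)
    (h : ∀ a ∈ A, ∀ b ∈ B, ¬ G.Adj a b) : Lay G Q (A ∪ B) (L ++ M) := by
  refine ⟨?_, ?_, ?_, cons_append hL.cons hM.cons
    fun a ha b hb => h _ (hL.memA ha) _ (hM.memA hb)⟩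
  · rw [List.map_append, List.nodup_append']
    refine ⟨hL.nodup, hM.nodup, fun w h1 h2 => ?_⟩
    exact Set.disjoint_left.1 hd ((hL.mem w).1 h1) ((hM.mem w).1 h2)
  · intro w
    rw [List.map_append, List.mem_append, hL.mem, hM.mem, Set.mem_union]
  · intro p hp
    rcases List.mem_append.1 hp with hp | hp
    exacts [hL.q p hp, hM.q p hp]

lemma Lay.iUnion {ι : Type*} {G : SimpleGraph V} {Q : V × ℕ → Prop} (A : ι → Set V)
    (S : Finset ι)
    (hd : ∀ i ∈ S, ∀ j ∈ S, i ≠ j → Disjoint (A i) (A j))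
    (he : ∀ i ∈ S, ∀ j ∈ S, i ≠ j → ∀ a ∈ A i, ∀ b ∈ A j, ¬ G.Adj a b)
    (hl : ∀ i ∈ S, ∃ L, Lay G Q (A i) L) : ∃ L, Lay G Q (⋃ i ∈ S, A i) L := by
  classical
  induction S using Finset.induction_on with
  | empty => exact ⟨[], (Lay.nil (Q := Q)).mono (by simp) (by simp)⟩
  | insert i S hi ih =>
    obtain ⟨L, hL⟩ := ih
      (fun a ha b hb => hd a (Finset.mem_insert_of_mem ha) b (Finset.mem_insert_of_mem hb))
      (fun a ha b hb => he a (Finset.mem_insert_of_mem ha) b (Finset.mem_insert_of_mem hb))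
      (fun a ha => hl a (Finset.mem_insert_of_mem ha))
    obtain ⟨M, hM⟩ := hl i (Finset.mem_insert_self _ _)
    refine ⟨M ++ L, (hM.append hL ?_ ?_).mono (by simp) (fun _ _ h => h)⟩
    · simp only [Set.disjoint_iUnion_right]
      intro j hj
      exact hd i (Finset.mem_insert_self _ _) j (Finset.mem_insert_of_mem hj)
        (by rintro rfl; exact hi hj)
    · intro a ha b hb
      simp only [Set.mem_iUnion] at hb
      obtain ⟨j, hj, hb⟩ := hb
      exact he i (Finset.mem_insert_self _ _) j (Finset.mem_insert_of_mem hj)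
        (by rintro rfl; exact hi hj) a ha b hb

lemma Lay.map {W : Type*} {G : SimpleGraph V} {H : SimpleGraph W} {k : ℕ} (f : W ↪ V)
    (hf : ∀ a b, G.Adj (f a) (f b) ↔ H.Adj a b) {L : List (W × ℕ)}
    (hL : Lay H (fun p => p.2 < k) Set.univ L) :
    Lay G (fun p => p.2 < k) (Set.range f) (L.map fun p => (f p.1, p.2)) := by
  have e : (L.map fun p => (f p.1, p.2)).map Prod.fst = (L.map Prod.fst).map f := by simp
  refine ⟨?_, ?_, ?_, ?_⟩
  · rw [e]; exact hL.nodup.map f.injective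
  · intro w
    rw [e, List.mem_map]
    constructor
    · rintro ⟨a, _, rfl⟩; exact ⟨a, rfl⟩
    · rintro ⟨a, rfl⟩; exact ⟨a, (hL.mem a).2 trivial, rfl⟩
  · intro p hp
    obtain ⟨q, hq, rfl⟩ := List.mem_map.1 hp
    exact hL.q q hq
  · intro a b c hs hab hac
    obtain ⟨l, hl, he⟩ := List.sublist_map_iff.1 hs
    rcases l with _ | ⟨a', _ | ⟨b', _ | ⟨c', _ | ⟨d', t⟩⟩⟩⟩ <;> simp at he
    obtain ⟨rfl, rfl, rfl⟩ := he
    rw [hf] at hac ⊢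
    exact hL.cons _ _ _ hl hab hac

lemma Lay.isKThin {G : SimpleGraph V} {k : ℕ} {L : List (V × ℕ)}
    (hL : Lay G (fun p => p.2 < k) Set.univ L) : IsKThin G k := by
  classical
  have hpos : ∀ w, ∃ i : Fin L.length, L[i].1 = w := by
    intro w
    have := (hL.mem w).2 trivial
    obtain ⟨p, hp, rfl⟩ := List.mem_map.1 this
    obtain ⟨i, hi, rfl⟩ := List.mem_iff_getElem.1 hp
    exact ⟨⟨i, hi⟩, rfl⟩
  choose pos hp using hpos
  have hinj : Function.Injective pos := fun a b h => by rw [← hp a, ← hp b, h]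
  refine ⟨fun u v => pos u < pos v, ?_, fun u => ⟨L[pos u].2, hL.q _ (by simp)⟩, ?_⟩
  · exact { trichotomous := fun a b h1 h2 => hinj (le_antisymm (not_lt.1 h2) (not_lt.1 h1))
            irrefl := fun a => lt_irrefl _
            trans := fun a b c => lt_trans }
  · intro u v w huv hvw hC hadj
    have hs : List.Sublist [L[pos u], L[pos v], L[pos w]] L := by
      have := List.map_getElem_sublist (l := L) (is := [pos u, pos v, pos w])
        (by simp [huv, hvw, lt_trans huv hvw])
      simpa using this
    have := hL.cons _ _ _ hs (by simpa using hC) (by rw [hp, hp]; exact hadj)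
    rwa [hp, hp] at this

/-- `v` is a neighbour of `x` having a big branch not through `x`. -/
def Act (G : SimpleGraph V) (m : ℕ) (x v : V) : Prop :=
  G.Adj x v ∧ ∃ u, G.Adj v u ∧ u ≠ x ∧ m ≤ (Br G v u).ncard + 2

lemma Act.card [Finite V] {G : SimpleGraph V} (hT : G.IsTree) {m : ℕ} {x v : V}
    (h : Act G m x v) : m ≤ (Br G x v).ncard + 1 := by
  obtain ⟨hxv, u, hvu, hux, hm⟩ := h
  have : (Br G v u).ncard < (Br G x v).ncard := by
    apply Set.ncard_lt_ncard _ (Set.toFinite _)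
    refine ⟨br_sub hT hxv hvu hux, fun hs => ?_⟩
    exact not_mem_br (hs (br_self hxv))
  omega

lemma act_three [Fintype V] {G : SimpleGraph V} (hT : G.IsTree) {m : ℕ} {x v₁ v₂ v₃ : V}
    (hcard : Fintype.card V + 2 < 3 * m)
    (h₁ : Act G m x v₁) (h₂ : Act G m x v₂) (h₃ : Act G m x v₃)
    (h12 : v₁ ≠ v₂) (h13 : v₁ ≠ v₃) (h23 : v₂ ≠ v₃) : False := by
  have c1 := h₁.card hT
  have c2 := h₂.card hT
  have c3 := h₃.card hT
  have u1 : (Br G x v₁ ∪ Br G x v₂).ncard = _ :=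
    Set.ncard_union_eq (br_disjoint hT h₁.1 h₂.1 h12) (Set.toFinite _) (Set.toFinite _)
  have u2 : (Br G x v₁ ∪ Br G x v₂ ∪ Br G x v₃).ncard = _ :=
    Set.ncard_union_eq (Set.disjoint_union_left.2
      ⟨br_disjoint hT h₁.1 h₃.1 h13, br_disjoint hT h₂.1 h₃.1 h23⟩)
      (Set.toFinite _) (Set.toFinite _)
  have u3 : (insert x (Br G x v₁ ∪ Br G x v₂ ∪ Br G x v₃)).ncard = _ :=
    Set.ncard_insert_of_notMem (by
      rintro ((h | h) | h) <;> exact not_mem_br h) (Set.toFinite _)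
  have u4 : (insert x (Br G x v₁ ∪ Br G x v₂ ∪ Br G x v₃)).ncard ≤ Fintype.card V := by
    rw [← Nat.card_eq_fintype_card, ← Set.ncard_univ]
    exact Set.ncard_le_ncard (Set.subset_univ _) (Set.toFinite _)
  omega

/-- The branch `y → x` has a layout ending with `x`. -/
def Good (G : SimpleGraph V) (j : ℕ) (A : Set V) (x : V) : Prop :=
  ∃ L, Lay G (fun p => p.2 < j + 1) A (L ++ [(x, j)])

/-- Layout of a non-active branch. -/
lemma lay_inactive [Fintype V] {G : SimpleGraph V} (hT : G.IsTree) {j m : ℕ}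
    (IH : ∀ v u, G.Adj v u → (Br G v u).ncard + 2 < m →
      ∃ L, Lay G (fun p => p.2 < j) (Br G v u) L)
    {x v : V} (hv : G.Adj x v) (hact : ¬ Act G m x v) :
    ∃ L, Lay G (fun p => p.2 < j + 1 ∧ (p.2 = j ↔ G.Adj p.1 x)) (Br G x v) L := by
  classical
  let S : Finset V := Finset.univ.filter fun u => G.Adj v u ∧ u ≠ x
  have hS : ∀ u, u ∈ S ↔ G.Adj v u ∧ u ≠ x := by simp [S]
  obtain ⟨E, hE⟩ := Lay.iUnion (G := G) (Q := fun p => p.2 < j) (fun u => Br G v u) S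
    (fun a ha b hb hne => br_disjoint hT ((hS a).1 ha).1 ((hS b).1 hb).1 hne)
    (fun a ha b hb hne p hp q hq => br_no_edge hT ((hS a).1 ha).1 ((hS b).1 hb).1 hne hp hq)
    (fun u hu => by
      obtain ⟨h1, h2⟩ := (hS u).1 hu
      refine IH v u h1 ?_
      by_contra hcon
      exact hact ⟨hv, u, h1, h2, by omega⟩)
  have hB : ∀ w, w ∈ Br G x v ↔ w = v ∨ w ∈ ⋃ u ∈ S, Br G v u := by
    intro w
    rw [br_decomp hT hv]
    simp [hS]
  have hvE : v ∉ ⋃ u ∈ S, Br G v u := by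
    simp only [Set.mem_iUnion, not_exists]
    intro u _
    exact not_mem_br
  refine ⟨(v, j) :: E, ?_, ?_, ?_, ?_⟩
  · rw [List.map_cons, List.nodup_cons, hE.mem]
    exact ⟨hvE, hE.nodup⟩
  · intro w
    rw [List.map_cons, List.mem_cons, hE.mem, hB]
  · intro p hp
    rcases List.mem_cons.1 hp with rfl | hp
    · simp [hv.symm]
    · have h1 : p.2 < j := hE.q p hp
      have h2 := hE.memA hp
      have h3 : p.1 ≠ v := fun h => hvE (h ▸ h2)
      have h4 := br_adj_root hT hv ((hB p.1).2 (Or.inr h2))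
      refine ⟨by omega, ?_⟩
      rw [h4]
      exact ⟨fun h => by omega, fun h => absurd h h3⟩
  · exact cons_cons hE.cons (fun p hp => by have := hE.q p hp; simp only at this ⊢; omega)

/-- Extension of a layout at `x`. -/
lemma good_extend [Fintype V] {G : SimpleGraph V} (hT : G.IsTree) {j m : ℕ}
    (IH : ∀ v u, G.Adj v u → (Br G v u).ncard + 2 < m →
      ∃ L, Lay G (fun p => p.2 < j) (Br G v u) L)
    {x : V} (S : Finset V) (hS : ∀ v ∈ S, G.Adj x v)
    (hg : ∀ v ∈ S, Act G m x v → Good G j (Br G x v) v)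
    (hu : ∀ v ∈ S, ∀ v' ∈ S, Act G m x v → Act G m x v' → v = v')
    {A : Set V} (hA : ∀ w, w ∈ A ↔ w = x ∨ ∃ v ∈ S, w ∈ Br G x v) :
    Good G j A x := by
  classical
  -- the layout of all non-active branches
  have hM : ∀ S' ⊆ S, (∀ v ∈ S', ¬ Act G m x v) →
      ∃ M, Lay G (fun p => p.2 < j + 1 ∧ (p.2 = j ↔ G.Adj p.1 x)) (⋃ v ∈ S', Br G x v) M := by
    intro S' hS' hna
    exact Lay.iUnion (fun v => Br G x v) S'
      (fun a ha b hb hne => br_disjoint hT (hS a (hS' ha)) (hS b (hS' hb)) hne)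
      (fun a ha b hb hne p hp q hq =>
        br_no_edge hT (hS a (hS' ha)) (hS b (hS' hb)) hne hp hq)
      (fun v hv => lay_inactive hT IH (hS v (hS' hv)) (hna v hv))
  -- appending x
  have fin : ∀ (K : List (V × ℕ)) (B : Set V), Lay G (fun p => p.2 < j + 1) B K →
      (∀ w, w ∈ A ↔ w = x ∨ w ∈ B) → x ∉ B →
      (∀ a b, List.Sublist [a, b] K → a.2 = b.2 → G.Adj a.1 x → G.Adj b.1 x) →
      Good G j A x := by
    intro K B hK hAB hx hc
    refine ⟨K, ?_, ?_, ?_, cons_snoc hK.cons hc⟩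
    · rw [List.map_append, List.nodup_append']
      refine ⟨hK.nodup, by simp, ?_⟩
      intro w h1 h2
      simp at h2
      subst h2
      exact hx ((hK.mem _).1 h1)
    · intro w
      rw [List.map_append, List.mem_append, hK.mem, hAB]
      simp [or_comm]
    · intro p hp
      rcases List.mem_append.1 hp with hp | hp
      · exact hK.q p hp
      · simp at hp; subst hp; simp
  by_cases hex : ∃ y ∈ S, Act G m x y
  · obtain ⟨y, hyS, hy⟩ := hex
    obtain ⟨L, hL⟩ := hg y hyS hy
    obtain ⟨M, hM⟩ := hM (S.erase y) (Finset.erase_subset _ _) (by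
      intro v hv hact
      exact Finset.ne_of_mem_erase hv (hu v (Finset.mem_of_mem_erase hv) y hyS hact hy))
    have hap := hL.append (hM.mono rfl (fun p _ h => h.1)) (by
        simp only [Set.disjoint_iUnion_right]
        intro v hv
        exact br_disjoint hT (hS y hyS) (hS v (Finset.mem_of_mem_erase hv))
          (Finset.ne_of_mem_erase hv).symm) (by
        intro a ha b hb
        simp only [Set.mem_iUnion] at hb
        obtain ⟨v, hv, hb⟩ := hb
        exact br_no_edge hT (hS y hyS) (hS v (Finset.mem_of_mem_erase hv))
          (Finset.ne_of_mem_erase hv).symm ha hb)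
    refine fin _ _ hap ?_ ?_ ?_
    · intro w
      rw [hA]
      simp only [Set.mem_union, Set.mem_iUnion, Finset.mem_erase]
      constructor
      · rintro (h | ⟨v, hv, hw⟩)
        · exact Or.inl h
        · by_cases hvy : v = y
          · subst hvy; exact Or.inr (Or.inl hw)
          · exact Or.inr (Or.inr ⟨v, ⟨hvy, hv⟩, hw⟩)
      · rintro (h | h | ⟨v, ⟨_, hv⟩, hw⟩)
        · exact Or.inl h
        · exact Or.inr ⟨y, hyS, h⟩
        · exact Or.inr ⟨v, hv, hw⟩
    · simp only [Set.mem_union, Set.mem_iUnion, not_or, not_exists]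
      exact ⟨not_mem_br, fun v _ => not_mem_br⟩
    · intro a b hs hab hax
      have hbM : b ∈ M → a.2 = j → G.Adj b.1 x := fun hb h =>
        (hM.q b hb).2.1 (by omega)
      have key : ∀ p ∈ L ++ [(y, j)], G.Adj p.1 x → p.1 = y := fun p hp hpx =>
        (br_adj_root hT (hS y hyS) (hL.memA hp)).1 hpx
      have hyL : ∀ p ∈ L, p.1 ≠ y := by
        intro p hp hpy
        have := hL.nodup
        rw [List.map_append, List.nodup_append'] at this
        exact this.2.2 (List.mem_map_of_mem hp) (by simp [hpy])
      rw [List.append_assoc, List.sublist_append_iff] at hs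
      obtain ⟨l₁, l₂, he, h1, h2⟩ := hs
      rcases l₁ with _ | ⟨a', t⟩
      · simp only [List.nil_append] at he
        subst he
        rw [List.singleton_append, List.sublist_cons_iff] at h2
        rcases h2 with h2 | ⟨r, he, hr⟩
        · exact hbM (h2.subset (by simp)) ((hM.q a (h2.subset (by simp))).2.2 hax)
        · simp at he
          obtain ⟨rfl, rfl⟩ := he
          exact hbM (hr.subset (by simp)) rfl
      · simp only [List.cons_append, List.cons.injEq] at he
        obtain ⟨rfl, _⟩ := he
        have ha : a ∈ L := h1.subset (by simp)
        exact absurd (key a (by simp [ha]) hax) (hyL a ha)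
  · push Not at hex
    obtain ⟨M, hM⟩ := hM S subset_rfl hex
    refine fin M _ (hM.mono rfl (fun p _ h => h.1)) ?_ ?_ ?_
    · intro w
      rw [hA]
      simp
    · simp only [Set.mem_iUnion, not_exists]
      exact fun v _ => not_mem_br
    · intro a b hs hab hax
      have ha := hM.q a (hs.subset (by simp))
      have hb := hM.q b (hs.subset (by simp))
      exact hb.2.1 (by rw [← hab]; exact ha.2.2 hax)

lemma br_card_lt [Finite V] {G : SimpleGraph V} (hT : G.IsTree) {x y v : V} (hy : G.Adj y x)
    (hv : G.Adj x v) (hne : v ≠ y) : (Br G x v).ncard < (Br G y x).ncard := by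
  apply Set.ncard_lt_ncard _ (Set.toFinite _)
  exact ⟨br_sub hT hy hv hne, fun hs => not_mem_br (hs (br_self hy))⟩

lemma good_of_act [Fintype V] {G : SimpleGraph V} (hT : G.IsTree) {j m : ℕ}
    (IH : ∀ v u, G.Adj v u → (Br G v u).ncard + 2 < m →
      ∃ L, Lay G (fun p => p.2 < j) (Br G v u) L)
    (hcard : Fintype.card V + 2 < 3 * m) :
    ∀ n : ℕ, ∀ x y, (Br G y x).ncard = n → Act G m x y → Good G j (Br G y x) x := by
  classical
  intro n
  induction n using Nat.strong_induction_on with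
  | _ n ih =>
    intro x y hn hact
    have hxy := hact.1
    refine good_extend hT IH (Finset.univ.filter fun v => G.Adj x v ∧ v ≠ y)
      (by simp +contextual) ?_ ?_ ?_
    · intro v hv hav
      simp only [Finset.mem_filter, Finset.mem_univ, true_and] at hv
      refine ih _ (hn ▸ br_card_lt hT hxy.symm hv.1 hv.2) v x rfl ⟨hv.1.symm, y, hxy, hv.2.symm, ?_⟩
      have := hact.card hT
      omega
    · intro v hv v' hv' ha ha'
      simp only [Finset.mem_filter, Finset.mem_univ, true_and] at hv hv'
      by_contra hne
      exact act_three hT hcard ha ha' hact hne hv.2 hv'.2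
    · intro w
      rw [br_decomp hT hxy.symm]
      simp

theorem exists_layout.{u} (k : ℕ) : ∀ {V : Type u} [Fintype V] (G : SimpleGraph V), G.IsTree →
    Fintype.card V + 2 < 3 ^ (k + 1) → ∃ L, Lay G (fun p => p.2 < k) Set.univ L := by
  induction k with
  | zero =>
    intro V _ G hT hc
    have := hT.connected.nonempty
    have := Fintype.card_pos (α := V)
    simp at hc
    omega
  | succ j ihk =>
    intro V _ G hT hc
    classical
    have IH : ∀ v u, G.Adj v u → (Br G v u).ncard + 2 < 3 ^ (j + 1) →
        ∃ L, Lay G (fun p => p.2 < j) (Br G v u) L := by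
      intro v u hvu hlt
      obtain ⟨L, hL⟩ := ihk (G.induce (Br G v u)) (br_tree hT hvu) (by
        rwa [← Nat.card_eq_fintype_card, Nat.card_coe_set_eq])
      exact ⟨_, (hL.map (G := G) (Function.Embedding.subtype _) (by simp)).mono (by simp)
        (fun _ _ h => h)⟩
    have hcard : Fintype.card V + 2 < 3 * 3 ^ (j + 1) := by
      rw [pow_succ] at hc; omega
    suffices h : ∃ x, Good G j Set.univ x by
      obtain ⟨x, L, hL⟩ := h
      exact ⟨_, hL⟩
    have hA : ∀ x w : V, w ∈ (Set.univ : Set V) ↔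
        w = x ∨ ∃ v ∈ Finset.univ.filter (fun v => G.Adj x v), w ∈ Br G x v := by
      intro x w
      simp only [Set.mem_univ, Finset.mem_filter, Finset.mem_univ, true_and, true_iff]
      by_cases h : w = x
      · exact Or.inl h
      · exact Or.inr (closer_exists hT h)
    by_cases hex : ∃ p : V × V, Act G (3 ^ (j + 1)) p.1 p.2
    · obtain ⟨⟨y, x⟩, hp, hmin⟩ := Set.exists_min_image
        {p : V × V | Act G (3 ^ (j + 1)) p.1 p.2} (fun p => (Br G p.1 p.2).ncard)
        (Set.toFinite _) hex
      have hyx : Act G (3 ^ (j + 1)) y x := hp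
      have only : ∀ v, Act G (3 ^ (j + 1)) x v → v = y := by
        intro v hv
        by_contra hne
        have h1 := hmin (x, v) hv
        have h2 := br_card_lt hT hyx.1 hv.1 hne
        simp only at h1
        omega
      refine ⟨x, good_extend hT IH _ (by simp) ?_ ?_ (hA x)⟩
      · intro v _ hv
        have := only v hv
        subst this
        exact good_of_act hT IH hcard _ v x rfl hyx
      · intro v _ v' _ h h'
        rw [only v h, only v' h']
    · push Not at hex
      obtain ⟨x⟩ := hT.connected.nonempty
      exact ⟨x, good_extend hT IH _ (by simp) (fun v _ h => absurd h (hex (x, v)))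
        (fun v _ v' _ h => absurd h (hex (x, v))) (hA x)⟩

theorem thinness_le_logb [Fintype V] (G : SimpleGraph V) (hT : G.IsTree) :
    (Thinness G : ℝ) ≤ Real.logb 3 (Fintype.card V + 2) := by
  have key : 3 ^ Thinness G ≤ Fintype.card V + 2 := by
    rcases ht : Thinness G with _ | k
    · simp
    · by_contra hlt
      obtain ⟨L, hL⟩ := exists_layout k G hT (by omega)
      have : Thinness G ≤ k := Nat.sInf_le hL.isKThin
      omega
  rw [Real.le_logb_iff_rpow_le (by norm_num) (by positivity), Real.rpow_natCast]
  exact_mod_cast key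
end

section
/- Let m ≥ 3 and let T be the complete m-ary tree of height h. Then thin(T) = ⌈(h+1)/2⌉. -/
open SimpleGraph

variable {V : Type*}

def IsCompleteMAryTree (G : SimpleGraph V) (rt : V) (m h : ℕ) : Prop :=
  G.IsTree ∧ ∀ v : V,
    {c | IsChild G rt v c}.ncard = m ∨ ({c | IsChild G rt v c} = ∅ ∧ G.dist rt v = h)

section Aux

open Relation

/-- abstract rooted-forest data -/
structure RData (G : SimpleGraph V) (R : V → V → Prop) (dep : V → ℕ) : Prop where
  dep_eq : ∀ a c, R a c → dep c = dep a + 1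
  uniq : ∀ a b c, R a c → R b c → a = b
  adj : ∀ a b, G.Adj a b ↔ R a b ∨ R b a

theorem RData.dep_le {G : SimpleGraph V} {R : V → V → Prop} {dep : V → ℕ} (H : RData G R dep)
    {a b : V} (h : ReflTransGen R a b) : dep a ≤ dep b := by
  induction h with
  | refl => exact le_rfl
  | tail _ h ih => have := H.dep_eq _ _ h; omega

theorem RData.eq_of_dep {G : SimpleGraph V} {R : V → V → Prop} {dep : V → ℕ} (H : RData G R dep)
    {a b : V} (h : ReflTransGen R a b) (hd : dep a = dep b) : a = b := by
  rcases ReflTransGen.cases_head h with h | ⟨c, h1, h2⟩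
  · exact h
  · have := H.dep_eq _ _ h1
    have := H.dep_le h2
    omega

theorem RData.eq_of_common {G : SimpleGraph V} {R : V → V → Prop} {dep : V → ℕ}
    (H : RData G R dep) {a b z : V} (h1 : ReflTransGen R a z) (h2 : ReflTransGen R b z)
    (hd : dep a = dep b) : a = b := by
  have U : Relator.RightUnique (Function.swap R) := fun x y w hy hw => H.uniq _ _ _ hy hw
  have h1' : ReflTransGen (Function.swap R) z a := reflTransGen_swap.2 h1
  have h2' : ReflTransGen (Function.swap R) z b := reflTransGen_swap.2 h2
  rcases ReflTransGen.total_of_right_unique U h1' h2' with h | h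
  · exact (H.eq_of_dep (reflTransGen_swap.1 h) hd.symm).symm
  · exact H.eq_of_dep (reflTransGen_swap.1 h) hd

theorem cross_chain {R : V → V → Prop} {x v p : V} (hxv : R x v) (h : ReflTransGen R v p)
    (Q : V → Prop) (hx : Q x) (hp : ¬ Q p) :
    ∃ y z, R y z ∧ Q y ∧ ¬ Q z ∧ (y = x ∨ ReflTransGen R v y) ∧ ReflTransGen R v z := by
  induction h with
  | refl => exact ⟨x, v, hxv, hx, hp, Or.inl rfl, .refl⟩
  | @tail b c hb hbc ih =>
    by_cases hQ : Q b
    · exact ⟨b, c, hbc, hQ, hp, Or.inr hb, hb.tail hbc⟩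
    · exact ih hQ

/-- certificate of a set of `k` pairwise conflicting vertices in the subtree of `x` -/
def Cert [LinearOrder V] (G : SimpleGraph V) (R : V → V → Prop) (x p : V) (S : Finset V) : Prop :=
  ReflTransGen R x p ∧ (∀ s ∈ S, s ≤ p) ∧ (∀ s ∈ S, ReflTransGen R x s) ∧
  ∀ s ∈ S, s ≠ p → ∃ b, ReflTransGen R x b ∧ p < b ∧ G.Adj s b ∧ ∀ t ∈ S, t ≠ s → ¬ G.Adj t b

theorem cert_step [LinearOrder V] {G : SimpleGraph V} {R : V → V → Prop} {dep : V → ℕ}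
    (H : RData G R dep) {x v1 v2 v3 u1 u2 u3 p1 p2 p3 : V}
    (h1 : R x v1) (h2 : R x v2) (h3 : R x v3) (n12 : v1 ≠ v2) (n23 : v2 ≠ v3)
    (k1 : R v1 u1) (k2 : R v2 u2) (k3 : R v3 u3) {S : Finset V}
    (c1 : ReflTransGen R u1 p1) (c2 : Cert G R u2 p2 S) (c3 : ReflTransGen R u3 p3)
    (l12 : p1 < p2) (l23 : p2 < p3) : ∃ S', Cert G R x p2 S' ∧ S'.card = S.card + 1 := by
  have d1 := H.dep_eq _ _ h1
  have d2 := H.dep_eq _ _ h2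
  have d3 := H.dep_eq _ _ h3
  obtain ⟨e1, e2, e3, e4⟩ := c2
  have hxu2 : ReflTransGen R x u2 := (ReflTransGen.single h2).tail k2
  -- the good set
  have good : ∀ y, (y = x ∨ ReflTransGen R v1 y ∨ ReflTransGen R v3 y) →
      ¬ ReflTransGen R v2 y := by
    rintro y (rfl | hy | hy) h
    · have := H.dep_le h; omega
    · exact n12 (H.eq_of_common hy h (by omega))
    · exact n23 (H.eq_of_common h hy (by omega))
  have nadj : ∀ y z, ¬ ReflTransGen R v2 y → ReflTransGen R u2 z → ¬ G.Adj y z := by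
    intro y z hy hz ha
    rcases (H.adj _ _).1 ha with h | h
    · rcases ReflTransGen.cases_tail hz with h' | ⟨c, hc, hcz⟩
      · subst h'
        have := H.uniq _ _ _ h k2
        subst this
        exact hy .refl
      · have := H.uniq _ _ _ h hcz
        subst this
        exact hy (ReflTransGen.head k2 hc)
    · exact hy ((ReflTransGen.head k2 hz).tail h)
  have hp2 : ReflTransGen R v2 p2 := ReflTransGen.head k2 e1
  have key : ∃ a b, G.Adj a b ∧ a < p2 ∧ p2 < b ∧ ¬ ReflTransGen R v2 a ∧ ¬ ReflTransGen R v2 b ∧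
      ReflTransGen R x a ∧ ReflTransGen R x b := by
    rcases lt_trichotomy x p2 with hx | hx | hx
    · obtain ⟨y, z, a1, a2, a3, a4, a5⟩ := cross_chain h3 (ReflTransGen.head k3 c3)
        (fun t => t < p2) hx (not_lt.2 l23.le)
      have gz := good z (Or.inr (Or.inr a5))
      refine ⟨y, z, (H.adj _ _).2 (Or.inl a1), a2, ?_, good y ?_, gz, ?_, ReflTransGen.head h3 a5⟩
      · refine lt_of_le_of_ne (not_lt.1 a3) ?_
        rintro rfl
        exact gz hp2
      · tauto
      · rcases a4 with rfl | a4
        · exact .refl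
        · exact ReflTransGen.head h3 a4
    · exact absurd hp2 (good p2 (Or.inl hx.symm))
    · obtain ⟨y, z, a1, a2, a3, a4, a5⟩ := cross_chain h1 (ReflTransGen.head k1 c1)
        (fun t => p2 < t) hx (not_lt.2 l12.le)
      have gz := good z (Or.inr (Or.inl a5))
      refine ⟨z, y, (H.adj _ _).2 (Or.inr a1), ?_, a2, gz, good y ?_, ReflTransGen.head h1 a5, ?_⟩
      · refine lt_of_le_of_ne (not_lt.1 a3) ?_
        rintro rfl
        exact gz hp2
      · tauto
      · rcases a4 with rfl | a4
        · exact .refl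
        · exact ReflTransGen.head h1 a4
  obtain ⟨a, b, ab, la, lb, ga, gb, ra, rb⟩ := key
  have haS : a ∉ S := fun h => ga (ReflTransGen.head k2 (e3 a h))
  refine ⟨insert a S, ⟨hxu2.trans e1, ?_, ?_, ?_⟩, Finset.card_insert_of_notMem haS⟩
  · intro s hs
    rcases Finset.mem_insert.1 hs with rfl | hs
    · exact la.le
    · exact e2 s hs
  · intro s hs
    rcases Finset.mem_insert.1 hs with rfl | hs
    · exact ra
    · exact hxu2.trans (e3 s hs)
  · intro s hs hsp
    rcases Finset.mem_insert.1 hs with rfl | hs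
    · refine ⟨b, rb, lb, ab, ?_⟩
      intro t ht hts hadj
      rcases Finset.mem_insert.1 ht with rfl | ht
      · exact hts rfl
      · exact nadj b t gb (e3 t ht) hadj.symm
    · obtain ⟨c, q1, q2, q3, q4⟩ := e4 s hs hsp
      refine ⟨c, hxu2.trans q1, q2, q3, ?_⟩
      intro t ht hts
      rcases Finset.mem_insert.1 ht with rfl | ht
      · exact nadj t c ga q1
      · exact q4 t ht hts

theorem cert_exists [LinearOrder V] {G : SimpleGraph V} {R : V → V → Prop} {dep : V → ℕ}
    (H : RData G R dep) (h : ℕ)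
    (hc : ∀ v, dep v < h → ∃ a b c, R v a ∧ R v b ∧ R v c ∧ a ≠ b ∧ a ≠ c ∧ b ≠ c) :
    ∀ n x, dep x + n = h → ∃ p S, Cert G R x p S ∧ S.card = (n + 2) / 2 := by
  have base : ∀ x, Cert G R x x {x} := by
    intro x
    refine ⟨.refl, by simp, ?_, ?_⟩
    · intro s hs
      rw [Finset.mem_singleton] at hs
      subst hs
      exact .refl
    · intro s hs hn
      exact absurd (Finset.mem_singleton.1 hs) hn
  intro n
  induction n using Nat.strong_induction_on with
  | _ n ih =>
    intro x hx
    rcases Nat.lt_or_ge n 2 with hn | hn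
    · exact ⟨x, {x}, base x, by rw [Finset.card_singleton]; omega⟩
    obtain ⟨v1, v2, v3, h1, h2, h3, n12, n13, n23⟩ := hc x (by omega)
    have d1 := H.dep_eq _ _ h1
    have d2 := H.dep_eq _ _ h2
    have d3 := H.dep_eq _ _ h3
    obtain ⟨u1, -, -, k1, -⟩ := hc v1 (by omega)
    obtain ⟨u2, -, -, k2, -⟩ := hc v2 (by omega)
    obtain ⟨u3, -, -, k3, -⟩ := hc v3 (by omega)
    have f1 := H.dep_eq _ _ k1
    have f2 := H.dep_eq _ _ k2
    have f3 := H.dep_eq _ _ k3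
    obtain ⟨p1, S1, c1, s1⟩ := ih (n - 2) (by omega) u1 (by omega)
    obtain ⟨p2, S2, c2, s2⟩ := ih (n - 2) (by omega) u2 (by omega)
    obtain ⟨p3, S3, c3, s3⟩ := ih (n - 2) (by omega) u3 (by omega)
    have ne : ∀ {v v' u u' p p'}, R x v → R x v' → R v u → R v' u' → v ≠ v' →
        ReflTransGen R u p → ReflTransGen R u' p' → p ≠ p' := by
      intro v v' u u' p p' a1 a2 a3 a4 a5 a6 a7 e
      subst e
      have := H.dep_eq _ _ a1
      have := H.dep_eq _ _ a2
      exact a5 (H.eq_of_common (ReflTransGen.head a3 a6) (ReflTransGen.head a4 a7) (by omega))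
    have q12 := ne h1 h2 k1 k2 n12 c1.1 c2.1
    have q13 := ne h1 h3 k1 k3 n13 c1.1 c3.1
    have q23 := ne h2 h3 k2 k3 n23 c2.1 c3.1
    have fin : ∀ {p} {S : Finset V}, S.card = (n - 2 + 2) / 2 →
        (∃ S', Cert G R x p S' ∧ S'.card = S.card + 1) →
        ∃ p S, Cert G R x p S ∧ S.card = (n + 2) / 2 := by
      rintro p S hS ⟨S', a, b⟩
      exact ⟨p, S', a, by omega⟩
    rcases lt_or_gt_of_ne q12 with l12 | l12 <;> rcases lt_or_gt_of_ne q13 with l13 | l13 <;>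
      rcases lt_or_gt_of_ne q23 with l23 | l23
    · exact fin s2 (cert_step H h1 h2 h3 n12 n23 k1 k2 k3 c1.1 c2 c3.1 l12 l23)
    · exact fin s3 (cert_step H h1 h3 h2 n13 n23.symm k1 k3 k2 c1.1 c3 c2.1 l13 l23)
    · exact absurd (l12.trans l23) l13.asymm
    · exact fin s1 (cert_step H h3 h1 h2 n13.symm n12 k3 k1 k2 c3.1 c1 c2.1 l13 l12)
    · exact fin s1 (cert_step H h2 h1 h3 n12.symm n13 k2 k1 k3 c2.1 c1 c3.1 l12 l13)
    · exact absurd (l23.trans l12) l13.asymm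
    · exact fin s3 (cert_step H h2 h3 h1 n23 n13.symm k2 k3 k1 c2.1 c3 c1.1 l23 l13)
    · exact fin s2 (cert_step H h3 h2 h1 n23.symm n12.symm k3 k2 k1 c3.1 c2 c1.1 l23 l12)

theorem cert_card [LinearOrder V] {G : SimpleGraph V} {R : V → V → Prop} {x p : V} {S : Finset V}
    (c : Cert G R x p S) {k : ℕ} {C : V → Fin k} (hC : Consistent G (· < ·) C) : S.card ≤ k := by
  have hlt : ∀ s ∈ S, ∀ t ∈ S, C s = C t → ¬ s < t := by
    intro s hs t ht e l
    obtain ⟨b, -, q2, q3, q4⟩ := c.2.2.2 s hs (ne_of_lt (l.trans_le (c.2.1 t ht)))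
    exact q4 t ht l.ne' (hC s t b l ((c.2.1 t ht).trans_lt q2) e q3)
  have : Set.InjOn C S := by
    intro s hs t ht e
    rcases lt_trichotomy s t with l | l | l
    · exact absurd l (hlt s hs t ht e)
    · exact l
    · exact absurd l (hlt t ht s hs e.symm)
  have := Finset.card_le_card_of_injOn (t := Finset.univ) C (fun _ _ => Finset.mem_univ _) this
  simpa using this

/-- the key of a vertex for the depth-first order -/
noncomputable def keyF (dep : V → ℕ) (par : V → V) (e : V → ℕ) (N : ℕ) (v : V) : ℕ → ℕ :=
  fun i => if i ≤ dep v then e (par^[dep v - i] v) + 1 else if Even (dep v) then N + 2 else 0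

theorem lex_convex {f g k : ℕ → ℕ} {n : ℕ} (h1 : toLex f < toLex g) (h2 : toLex g < toLex k)
    (hfk : ∀ i ≤ n, f i = k i) : ∀ i ≤ n, g i = f i := by
  obtain ⟨i, hi, hi'⟩ := h1
  obtain ⟨j, hj, hj'⟩ := h2
  simp only [Pi.toLex_apply] at hi hi' hj hj'
  intro t ht
  have hin : n < i := by
    by_contra hcon
    have e1 := hfk i (by omega)
    rcases lt_trichotomy i j with l | l | l
    · have := hj i l; omega
    · subst l; omega
    · have := hi j l; have := hfk j (by omega); omega
  exact (hi t (by omega)).symm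

theorem upper [Fintype V] {G : SimpleGraph V} {R : V → V → Prop} {dep : V → ℕ}
    (H : RData G R dep) (h : ℕ) (hh : ∀ v, dep v ≤ h) (hp : ∀ v, 0 < dep v → ∃ u, R u v) :
    IsKThin G ((h + 2) / 2) := by
  classical
  have : ∀ v, ∃ u, 0 < dep v → R u v := by
    intro v
    by_cases hv : 0 < dep v
    · obtain ⟨u, hu⟩ := hp v hv
      exact ⟨u, fun _ => hu⟩
    · exact ⟨v, fun h => absurd h hv⟩
  choose par hpar using this
  let e : V → ℕ := fun v => (Fintype.equivFin V v : ℕ)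
  have einj : ∀ u v, e u = e v → u = v := fun u v huv =>
    (Fintype.equivFin V).injective (Fin.ext huv)
  let N := Fintype.card V
  have eN : ∀ v, e v < N := fun v => (Fintype.equivFin V v).2
  let K := keyF dep par e N
  have Kin : ∀ v i, i ≤ dep v → K v i = e (par^[dep v - i] v) + 1 := by
    intro v i hi
    exact if_pos hi
  have Kev : ∀ v i, dep v < i → Even (dep v) → K v i = N + 2 := by
    intro v i hi hev
    have : ¬ i ≤ dep v := by omega
    simp [K, keyF, this, hev]
  have Kod : ∀ v i, dep v < i → ¬ Even (dep v) → K v i = 0 := by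
    intro v i hi hev
    have : ¬ i ≤ dep v := by omega
    simp only [K, keyF, this, hev, if_false]
  have Kself : ∀ v, K v (dep v) = e v + 1 := by
    intro v
    rw [Kin v _ le_rfl]; simp
  have Kle : ∀ v i x, K v i = e x + 1 → i ≤ dep v := by
    intro v i x hx
    by_contra hcon
    have := eN x
    by_cases hev : Even (dep v)
    · have := Kev v i (by omega) hev; omega
    · have := Kod v i (by omega) hev; omega
  have Kinj : Function.Injective (fun v => toLex (K v)) := by
    intro u v huv
    have huv : K u = K v := toLex.injective huv
    have h1 : K v (dep u) = e u + 1 := by rw [← huv]; exact Kself u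
    have h2 : K u (dep v) = e v + 1 := by rw [huv]; exact Kself v
    have l1 := Kle _ _ _ h1
    have l2 := Kle _ _ _ h2
    have : dep u = dep v := le_antisymm l1 l2
    rw [this, Kself] at h1
    exact (einj _ _ (by omega)).symm
  have Kchild : ∀ u w, R u w → ∀ i ≤ dep u, K u i = K w i := by
    intro u w huw i hi
    have d := H.dep_eq _ _ huw
    have hpw : par w = u := H.uniq _ _ _ (hpar w (by omega)) huw
    rw [Kin u i hi, Kin w i (by omega)]
    have : dep w - i = (dep u - i) + 1 := by omega
    rw [this, Function.iterate_succ_apply, hpw]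
  have ev_lt : ∀ u w, R u w → Even (dep u) → toLex (K w) < toLex (K u) := by
    intro u w huw hev
    have d := H.dep_eq _ _ huw
    refine ⟨dep u + 1, fun j hj => ?_, ?_⟩
    · exact (Kchild u w huw j (by omega)).symm
    · change K w (dep u + 1) < K u (dep u + 1)
      rw [Kev u _ (by omega) hev, ← d, Kself]
      have := eN w
      omega
  have od_lt : ∀ u w, R u w → ¬ Even (dep u) → toLex (K u) < toLex (K w) := by
    intro u w huw hev
    have d := H.dep_eq _ _ huw
    refine ⟨dep u + 1, fun j hj => ?_, ?_⟩
    · exact (Kchild u w huw j (by omega))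
    · change K u (dep u + 1) < K w (dep u + 1)
      rw [Kod u _ (by omega) hev, ← d, Kself]
      omega
  letI : LinearOrder V := LinearOrder.lift' (fun v => toLex (K v)) Kinj
  have ltK : ∀ u v : V, u < v → toLex (K u) < toLex (K v) := fun u v huv => huv
  refine ⟨(· < ·), inferInstance, fun v => ⟨dep v / 2, by have := hh v; omega⟩, ?_⟩
  intro u v w huv hvw hC hadj
  have huv' := ltK _ _ huv
  have hvw' := ltK _ _ hvw
  have hC : dep u / 2 = dep v / 2 := by simpa using hC
  rcases (H.adj _ _).1 hadj with hR | hR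
  · have d := H.dep_eq _ _ hR
    by_cases hev : Even (dep u)
    · exact absurd (huv'.trans hvw') (ev_lt _ _ hR hev).asymm
    · have hk := lex_convex huv' hvw' (Kchild u w hR) (dep u) le_rfl
      rw [Kself] at hk
      have l := Kle _ _ _ hk
      have : dep v = dep u := by
        rw [Nat.not_even_iff] at hev
        omega
      rw [← this, Kself] at hk
      have := einj v u (by omega)
      subst this
      exact absurd huv (lt_irrefl _)
  · have d := H.dep_eq _ _ hR
    by_cases hev : Even (dep w)
    · have hk := lex_convex huv' hvw' (fun i hi => (Kchild w u hR i hi).symm) (dep w) le_rfl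
      rw [← Kchild w u hR _ le_rfl, Kself] at hk
      have l := Kle _ _ _ hk
      rw [Kin v _ l] at hk
      have hk' := einj _ w (Nat.succ.inj hk)
      rw [Nat.even_iff] at hev
      have : dep v = dep w ∨ dep v = dep w + 1 := by omega
      rcases this with h' | h'
      · have : dep v - dep w = 0 := by omega
        rw [this] at hk'
        simp only [Function.iterate_zero, id] at hk'
        subst hk'
        exact absurd hvw (lt_irrefl _)
      · have : dep v - dep w = 1 := by omega
        rw [this] at hk'
        simp only [Function.iterate_one] at hk'
        refine (H.adj _ _).2 (Or.inr ?_)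
        rw [← hk']
        exact hpar v (by omega)
    · exact absurd (huv'.trans hvw') (od_lt _ _ hR hev).asymm

theorem tree_rdata {G : SimpleGraph V} (hT : G.IsTree) (rt : V) :
    RData G (IsChild G rt) (G.dist rt) := by
  refine ⟨fun a c h => h.2.symm, ?_, ?_⟩
  · intro a b c ha hb
    have key : ∀ a, IsChild G rt a c → ∃ p : G.Walk rt c, p.IsPath ∧ p.penultimate = a := by
      intro a ha
      obtain ⟨p, hp⟩ := hT.1.exists_walk_length_eq_dist rt a
      refine ⟨p.concat ha.1, ?_, by simp⟩
      apply Walk.isPath_of_length_eq_dist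
      rw [Walk.length_concat, hp, ha.2]
    obtain ⟨p, hp, rfl⟩ := key a ha
    obtain ⟨q, hq, rfl⟩ := key b hb
    rw [(hT.existsUnique_path rt c).unique hp hq]
  · intro a b
    constructor
    · intro h
      rcases hT.dist_eq_dist_add_one_of_adj rt h with h' | h'
      · exact Or.inr ⟨h.symm, by omega⟩
      · exact Or.inl ⟨h, by omega⟩
    · rintro (h | h)
      · exact h.1
      · exact h.1.symm

theorem tree_parent {G : SimpleGraph V} (hT : G.IsTree) (rt v : V) (hv : 0 < G.dist rt v) :
    ∃ u, IsChild G rt u v := by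
  obtain ⟨p, hp⟩ := hT.1.exists_walk_length_eq_dist rt v
  have hnn : ¬ p.Nil := by
    rw [Walk.nil_iff_length_eq]; omega
  have hadj := p.adj_penultimate hnn
  refine ⟨p.penultimate, hadj, ?_⟩
  have h1 : G.dist rt p.penultimate ≤ p.length - 1 := by
    have := dist_le p.dropLast
    simpa using this
  rcases hT.dist_eq_dist_add_one_of_adj rt hadj with h' | h' <;> omega

end Aux

theorem thinness_complete_m_ary [Fintype V] (G : SimpleGraph V) (rt : V) (m h : ℕ)
    (hm : 3 ≤ m) (hG : IsCompleteMAryTree G rt m h) :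
    Thinness G = (h + 2) / 2 := by
  classical
  obtain ⟨hT, hc⟩ := hG
  have H := tree_rdata hT rt
  have hh : ∀ v, G.dist rt v ≤ h := by
    haveI : Nonempty V := ⟨rt⟩
    obtain ⟨v, hv⟩ := Finite.exists_max (G.dist rt)
    intro w
    refine (hv w).trans ?_
    rcases hc v with h1 | h1
    · exfalso
      have : {c | IsChild G rt v c}.Nonempty := by
        apply Set.nonempty_of_ncard_ne_zero
        omega
      obtain ⟨c, hc'⟩ := this
      have := hv c
      have := hc'.2
      omega
    · exact h1.2.le
  have hup := upper H h hh (tree_parent hT rt)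
  refine le_antisymm (Nat.sInf_le hup) ?_
  refine le_csInf ⟨_, hup⟩ ?_
  rintro k ⟨r, hr, C, hC⟩
  letI : LinearOrder V := linearOrderOfSTO r
  have hch : ∀ v, G.dist rt v < h → ∃ a b c, IsChild G rt v a ∧ IsChild G rt v b ∧
      IsChild G rt v c ∧ a ≠ b ∧ a ≠ c ∧ b ≠ c := by
    intro v hv
    rcases hc v with h1 | h1
    · have h2 : 2 < {c | IsChild G rt v c}.ncard := by omega
      obtain ⟨a, b, c, q⟩ := (Set.two_lt_ncard_iff (Set.toFinite _)).1 h2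
      exact ⟨a, b, c, q⟩
    · omega
  obtain ⟨p, S, c, hS⟩ := cert_exists H h hch h rt (by simp)
  rw [← hS]
  exact cert_card c hC
end

section
/- For any tree T with diameter d in which every vertex has degree at most 3, thin(T) ≤ ⌈(d+3)/6⌉. -/
open SimpleGraph

variable {V : Type*}

namespace ThinAux

/-- The vertices on the `v`-side of the edge `p v`. -/
def br (G : SimpleGraph V) (p v : V) : Set V := {w | G.dist w p = G.dist w v + 1}

def Tri (Q : V → V → V → Prop) (L : List V) : Prop := ∀ u x w, [u, x, w].Sublist L → Q u x w

lemma tri_append {Q : V → V → V → Prop} {A B : List V} (hA : Tri Q A) (hB : Tri Q B)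
    (h1 : ∀ u x w, [u, x].Sublist A → w ∈ B → Q u x w)
    (h2 : ∀ u x w, u ∈ A → [x, w].Sublist B → Q u x w) : Tri Q (A ++ B) := by
  intro u x w h
  rw [List.sublist_append_iff] at h
  obtain ⟨l1, l2, he, hl1, hl2⟩ := h
  match l1, he with
  | [], he => simp at he; subst he; exact hB _ _ _ hl2
  | [a], he =>
    simp at he; obtain ⟨rfl, rfl⟩ := he
    exact h2 _ _ _ (by simpa using hl1) hl2
  | [a, b], he =>
    simp at he; obtain ⟨rfl, rfl, rfl⟩ := he
    exact h1 _ _ _ hl1 (by simpa using hl2)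
  | [a, b, c], he =>
    simp at he; obtain ⟨rfl, rfl, rfl, rfl⟩ := he
    exact hA _ _ _ hl1
  | a :: b :: c :: d :: l, he => simp at he

lemma tri_nil {Q : V → V → V → Prop} : Tri Q [] := by
  intro u x w h; simp at h

lemma tri_single {Q : V → V → V → Prop} (v : V) : Tri Q [v] := by
  intro u x w h; have := h.length_le; simp at this

lemma pair_mem {L : List V} {x y : V} (h : [x, y].Sublist L) : x ∈ L ∧ y ∈ L :=
  ⟨h.subset (by simp), h.subset (by simp)⟩

lemma pair_ne {L : List V} (hn : L.Nodup) {x y : V} (h : [x, y].Sublist L) : x ≠ y := by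
  have := hn.sublist h
  simpa using this

lemma pair_last {L : List V} {v y : V} (hn : (L ++ [v]).Nodup) : ¬ [v, y].Sublist (L ++ [v]) := by
  intro h
  rw [List.sublist_append_iff] at h
  obtain ⟨l1, l2, he, hl1, hl2⟩ := h
  have hv : v ∉ L := by
    intro hv; rw [List.nodup_append] at hn; exact hn.2.2 v hv v (by simp) rfl
  match l1, he with
  | [], he => simp at he; subst he; have := hl2.length_le; simp at this
  | a :: l, he =>
    simp at he; obtain ⟨rfl, -⟩ := he
    exact hv (hl1.subset (by simp))

lemma triple_of_pairs {L : List V} (hn : L.Nodup) {u x w : V} (h1 : [u, x].Sublist L)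
    (h2 : [x, w].Sublist L) : [u, x, w].Sublist L := by
  obtain ⟨s, t, rfl⟩ := List.append_of_mem (pair_mem h1).2
  have hs : x ∉ s := by
    intro hv; rw [List.nodup_append] at hn; exact hn.2.2 x hv x (by simp) rfl
  have ht : x ∉ t := by
    rw [List.nodup_append] at hn; exact (List.nodup_cons.1 hn.2.1).1
  have hu : u ∈ s := by
    rw [List.sublist_append_iff] at h1
    obtain ⟨l1, l2, he, hl1, hl2⟩ := h1
    match l1, he with
    | [], he =>
      simp at he; subst he
      rw [List.sublist_cons_iff] at hl2
      rcases hl2 with h | ⟨r, hr, h⟩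
      · exact absurd (h.subset (by simp)) ht
      · simp at hr; obtain ⟨-, rfl⟩ := hr; exact absurd (h.subset (by simp)) ht
    | a :: l, he =>
      simp at he; obtain ⟨rfl, -⟩ := he
      exact hl1.subset (by simp)
  have hw : w ∈ t := by
    rw [List.sublist_append_iff] at h2
    obtain ⟨l1, l2, he, hl1, hl2⟩ := h2
    match l1, he with
    | [], he =>
      simp at he; subst he
      rw [List.sublist_cons_iff] at hl2
      rcases hl2 with h | ⟨r, hr, h⟩
      · exact absurd (h.subset (by simp)) ht
      · simp at hr; subst hr; exact h.subset (by simp)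
    | a :: l, he =>
      simp at he; obtain ⟨rfl, -⟩ := he
      exact absurd (hl1.subset (by simp)) hs
  have : [u, x, w] = [u] ++ ([x] ++ [w]) := rfl
  rw [this]
  exact (List.singleton_sublist.2 hu).append ((List.Sublist.refl [x]).append
    (List.singleton_sublist.2 hw))

lemma pair_total {L : List V} {x y : V} (hx : x ∈ L) (hy : y ∈ L) (hne : x ≠ y) :
    [x, y].Sublist L ∨ [y, x].Sublist L := by
  obtain ⟨s, t, rfl⟩ := List.append_of_mem hx
  rw [List.mem_append, List.mem_cons] at hy
  rcases hy with h | h | h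
  · right
    exact (List.singleton_sublist.2 h).append (List.singleton_sublist.2 (by simp))
  · exact absurd h.symm hne
  · left
    exact List.Sublist.trans ((List.singleton_sublist.2 h).cons_cons x)
      (List.sublist_append_right _ _)

section tree
variable {G : SimpleGraph V}

lemma par_unique (hT : G.IsTree) {v c c' w : V} (h : G.Adj v c) (h' : G.Adj v c')
    (hc : G.dist w v = G.dist w c + 1) (hc' : G.dist w v = G.dist w c' + 1) : c = c' := by
  have key : ∀ c, G.Adj v c → G.dist w v = G.dist w c + 1 →
      ∃ p : G.Walk v w, p.IsPath ∧ p.snd = c := by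
    intro c h hc
    obtain ⟨q, hq⟩ := hT.connected.exists_walk_length_eq_dist c w
    refine ⟨Walk.cons h q, ?_, by simp⟩
    apply Walk.isPath_of_length_eq_dist
    rw [Walk.length_cons, hq, G.dist_comm (u := v), hc, G.dist_comm (u := c)]
  obtain ⟨p, hp, rfl⟩ := key c h hc
  obtain ⟨p', hp', rfl⟩ := key c' h' hc'
  rw [(hT.existsUnique_path v w).unique hp hp']

lemma par_exists (hT : G.IsTree) {v w : V} (h : w ≠ v) :
    ∃ c, G.Adj v c ∧ G.dist w v = G.dist w c + 1 := by
  obtain ⟨q, hq⟩ := hT.connected.exists_walk_length_eq_dist v w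
  cases q with
  | nil => exact absurd rfl h
  | cons hadj q =>
    rename_i c
    refine ⟨c, hadj, ?_⟩
    rw [Walk.length_cons] at hq
    have h1 := G.dist_le q
    have h2 := hT.dist_eq_dist_add_one_of_adj w hadj
    rw [G.dist_comm (u := v)] at hq
    rw [G.dist_comm (u := c)] at h1
    omega

lemma not_mem_br (hT : G.IsTree) {p v w : V} (h : G.Adj p v) : w ∉ br G p v ↔ w ∈ br G v p := by
  have := hT.dist_eq_dist_add_one_of_adj w h
  simp only [br, Set.mem_ofPred_eq]; omega

lemma cross (hT : G.IsTree) {a b w z : V} (h : G.Adj a b) (hw : w ∈ br G b a) (hz : z ∈ br G a b)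
    (hwz : G.Adj w z) : w = a ∧ z = b := by
  simp only [br, Set.mem_ofPred_eq] at hw hz
  have h1 := hT.dist_eq_dist_add_one_of_adj a hwz
  have h2 := hT.dist_eq_dist_add_one_of_adj b hwz
  simp only [G.dist_comm (u := a), G.dist_comm (u := b)] at h1 h2
  have h3 : G.dist z a = G.dist w a + 1 := by omega
  have h4 : G.dist w b = G.dist z b + 1 := by omega
  have hwa : w = a := by
    by_contra hne
    obtain ⟨c, hc, hc'⟩ := par_exists hT (v := w) (w := a) (Ne.symm hne)
    have h5 := hT.dist_eq_dist_add_one_of_adj b hc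
    have h6 := hT.dist_eq_dist_add_one_of_adj c h
    simp only [G.dist_comm (u := a), G.dist_comm (u := b)] at hc' h5
    have : c = z := par_unique hT (w := b) hc hwz
      (by simp only [G.dist_comm (u := b)]; omega) (by simp only [G.dist_comm (u := b)]; omega)
    subst this
    omega
  refine ⟨hwa, ?_⟩
  subst hwa
  rw [G.dist_self] at h3
  have : G.dist z b = 0 := by omega
  exact hT.connected.dist_eq_zero_iff.1 this

lemma br_sub (hT : G.IsTree) {p v c w : V} (hv : G.Adj p v) (hc : G.Adj v c) (hcp : c ≠ p)
    (hw : w ∈ br G v c) : w ∈ br G p v := by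
  by_contra h
  rw [not_mem_br hT hv] at h
  exact hcp (par_unique hT hc hv.symm hw h)

lemma walk_cross (hT : G.IsTree) {a b : V} (h : G.Adj a b) {w z : V} (q : G.Walk w z)
    (hw : w ∈ br G b a) (hz : z ∈ br G a b) : G.dist w a + 1 + G.dist z b ≤ q.length := by
  induction q with
  | nil => exact absurd hz ((not_mem_br hT h).2 hw)
  | cons hadj q ih =>
    rename_i w w' z
    rw [Walk.length_cons]
    by_cases h' : w' ∈ br G b a
    · have := ih h' hz
      have h1 := hT.dist_eq_dist_add_one_of_adj a hadj
      simp only [G.dist_comm (u := a)] at h1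
      omega
    · rw [not_mem_br hT h.symm] at h'
      obtain ⟨rfl, rfl⟩ := cross hT h hw h' hadj
      have := G.dist_le q
      rw [G.dist_comm] at this
      simp; omega

/-- colour-consistency of a triple, the colour being `D / 3` -/
def Q (G : SimpleGraph V) (D : V → ℕ) (u x w : V) : Prop :=
  D u / 3 = D x / 3 → G.Adj u w → G.Adj x w

/-- a layout of the branch at `v` -/
structure Good (G : SimpleGraph V) (D : V → ℕ) (p v : V) (L : List V) : Prop where
  nodup : L.Nodup
  mem : ∀ w, w ∈ L ↔ w ∈ br G p v
  last : D v % 3 = 1 → ∃ L', L = L' ++ [v]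
  tri : Tri (Q G D) L

/-- what we need from a (possibly empty) layout of a child branch of `v` -/
structure Part (G : SimpleGraph V) (D : V → ℕ) (p v : V) (L : List V) : Prop where
  nodup : L.Nodup
  sub : ∀ w ∈ L, w ∈ br G p v
  ne : v ∉ L
  out : ∀ u ∈ L, ∀ w, w ∉ L → G.Adj u w → w = v
  uniq : ∀ u ∈ L, ∀ w ∈ L, G.Adj u v → G.Adj w v → u = w
  two : ∀ u ∈ L, ∀ w ∈ L, G.Adj u v → G.dist w v = 2 → G.Adj w u
  last : D v % 3 = 0 → ∀ u x, [u, x].Sublist L → ¬ G.Adj u v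
  tri : Tri (Q G D) L

lemma part_nil (D : V → ℕ) (p v : V) : Part G D p v [] where
  nodup := by simp
  sub := by simp
  ne := by simp
  out := by simp
  uniq := by simp
  two := by simp
  last := by simp
  tri := tri_nil

lemma self_mem_br {p v : V} (h : G.Adj p v) : v ∈ br G p v := by
  simp [br, SimpleGraph.dist_eq_one_iff_adj, h.symm]

lemma root_of_adj (hT : G.IsTree) {v c u : V} (hc : G.Adj v c) (hu : u ∈ br G v c)
    (h : G.Adj u v) : u = c :=
  (cross hT hc (self_mem_br hc.symm) hu h.symm).2

lemma part_of_good (hT : G.IsTree) {D : V → ℕ} {p v c : V} {L : List V} (hv : G.Adj p v)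
    (hc : G.Adj v c) (hcp : c ≠ p) (hD : D c = D v + 1) (h : Good G D v c L) : Part G D p v L where
  nodup := h.nodup
  sub w hw := br_sub hT hv hc hcp ((h.mem w).1 hw)
  ne hw := by
    have := (h.mem v).1 hw
    simp [br] at this
  out u hu w hw hadj := by
    rw [h.mem] at hu hw
    rw [not_mem_br hT hc] at hw
    exact (cross hT hc hw hu hadj.symm).1
  uniq u hu w hw hau haw := by
    rw [h.mem] at hu hw
    rw [root_of_adj hT hc hu hau, root_of_adj hT hc hw haw]
  two u hu w hw hau h2 := by
    rw [h.mem] at hu hw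
    rw [root_of_adj hT hc hu hau, ← SimpleGraph.dist_eq_one_iff_adj]
    simp only [br, Set.mem_ofPred_eq] at hw
    omega
  last hm u x hs hadj := by
    have hu := (pair_mem hs).1
    rw [h.mem] at hu
    have := root_of_adj hT hc hu hadj
    subst this
    obtain ⟨L', rfl⟩ := h.last (by omega)
    exact pair_last h.nodup hs
  tri := h.tri

lemma combine (hT : G.IsTree) {D : V → ℕ} {p v : V} (hv : G.Adj p v)
    (hD : ∀ w ∈ br G p v, D w = D v + G.dist w v) {A B : List V}
    (hA : Part G D p v A) (hB : Part G D p v B) (hAB : ∀ u ∈ A, u ∉ B)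
    (hcov : ∀ w ∈ br G p v, w ≠ v → w ∈ A ∨ w ∈ B) : ∃ L, Good G D p v L := by
  have hAm : ∀ w ∈ A, w ≠ v := fun w hw h => hA.ne (h ▸ hw)
  have hBm : ∀ w ∈ B, w ≠ v := fun w hw h => hB.ne (h ▸ hw)
  have hBA : ∀ u ∈ B, u ∉ A := fun u hu h => hAB u h hu
  have hpos : ∀ w, w ≠ v → 1 ≤ G.dist w v := fun w h => hT.connected.pos_dist_of_ne h
  have hone : ∀ w, G.Adj w v ↔ G.dist w v = 1 := fun w => SimpleGraph.dist_eq_one_iff_adj.symm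
  have noAB : ∀ u ∈ A, ∀ w ∈ B, ¬ G.Adj u w := fun u hu w hw h =>
    hBm w hw (hA.out u hu w (hBA w hw) h)
  have hvm := self_mem_br hv
  have hlt := Nat.mod_lt (D v) (show 3 > 0 by norm_num)
  have hndAB : (A ++ B).Nodup := by
    rw [List.nodup_append]
    exact ⟨hA.nodup, hB.nodup, fun a ha b hb hab => hAB a ha (hab ▸ hb)⟩
  have htriAB : Tri (Q G D) (A ++ B) := by
    refine tri_append hA.tri hB.tri ?_ ?_
    · intro u x w h hw _ hadj
      exact absurd hadj (noAB u (pair_mem h).1 w hw)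
    · intro u x w hu h _ hadj
      exact absurd hadj (noAB u hu w (pair_mem h).2)
  have hDAB : ∀ w, w ∈ A ++ B → D w = D v + G.dist w v ∧ 1 ≤ G.dist w v := by
    intro w hw
    rcases List.mem_append.1 hw with h | h
    · exact ⟨hD w (hA.sub w h), hpos w (hAm w h)⟩
    · exact ⟨hD w (hB.sub w h), hpos w (hBm w h)⟩
  have hmem : ∀ w, (w = v ∨ w ∈ A ∨ w ∈ B) ↔ w ∈ br G p v := by
    intro w
    constructor
    · rintro (rfl | h | h)
      exacts [hvm, hA.sub w h, hB.sub w h]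
    · intro h
      by_cases hw : w = v
      · exact Or.inl hw
      · exact Or.inr (hcov w h hw)
  have hvAB : v ∉ A ++ B := by simp [hA.ne, hB.ne]
  obtain h0 | h1 | h2 : D v % 3 = 0 ∨ D v % 3 = 1 ∨ D v % 3 = 2 := by omega
  · refine ⟨A ++ ([v] ++ B), ?_, ?_, by omega, ?_⟩
    · have : (A ++ ([v] ++ B)).Perm (v :: (A ++ B)) := by
        simp
      rw [this.nodup_iff, List.nodup_cons]
      exact ⟨hvAB, hndAB⟩
    · intro w; rw [← hmem]; simp; tauto
    · refine tri_append hA.tri (tri_append (tri_single v) hB.tri ?_ ?_) ?_ ?_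
      · intro u x w h; have := h.length_le; simp at this
      · intro u x w hu hxw hcol hadj
        simp at hu; subst hu
        obtain ⟨hx, hw⟩ := pair_mem hxw
        have h3 := hD x (hB.sub x hx)
        have h4 := hpos x (hBm x hx)
        obtain h5 | h5 : G.dist x u = 1 ∨ G.dist x u = 2 := by omega
        · exact absurd (hB.uniq x hx w hw ((hone x).2 h5) hadj.symm) (pair_ne hB.nodup hxw)
        · exact hB.two w hw x hx hadj.symm h5
      · intro u x w hux hw _ hadj
        have hu := (pair_mem hux).1
        simp at hw
        rcases hw with rfl | hw
        · exact absurd hadj (hA.last h0 u x hux)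
        · exact absurd hadj (noAB u hu w hw)
      · intro u x w hu hxw _ hadj
        have hw : w ∈ B := by
          rw [List.singleton_append, List.sublist_cons_iff] at hxw
          rcases hxw with h | ⟨r, hr, h⟩
          · exact (pair_mem h).2
          · simp at hr; obtain ⟨-, rfl⟩ := hr; simpa using h
        exact absurd hadj (noAB u hu w hw)
  · refine ⟨(A ++ B) ++ [v], ?_, ?_, fun _ => ⟨_, rfl⟩, ?_⟩
    · rw [List.nodup_append]
      refine ⟨hndAB, by simp, fun a ha b hb hab => ?_⟩
      simp at hb; subst hb; subst hab; exact hvAB ha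
    · intro w; rw [← hmem]; simp; tauto
    · refine tri_append htriAB (tri_single v) ?_ ?_
      · intro u x w hux hw hcol hadj
        simp at hw; subst hw
        obtain ⟨hu, hx⟩ := pair_mem hux
        have h3 := hDAB u hu
        have h4 := hDAB x hx
        rw [hone] at hadj ⊢
        omega
      · intro u x w hu h; have := h.length_le; simp at this
  · refine ⟨[v] ++ (A ++ B), ?_, ?_, by omega, ?_⟩
    · rw [List.singleton_append, List.nodup_cons]; exact ⟨hvAB, hndAB⟩
    · intro w; rw [← hmem]; simp
    · refine tri_append (tri_single v) htriAB ?_ ?_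
      · intro u x w h; have := h.length_le; simp at this
      · intro u x w hu hxw hcol hadj
        simp at hu; subst hu
        have h4 := hDAB x (pair_mem hxw).1
        omega

lemma children [Finite V] {p v : V} (hv : G.Adj p v) (hdeg : (G.neighborSet v).ncard ≤ 3) :
    (∀ c, G.Adj v c → c = p) ∨ (∃ c1, G.Adj v c1 ∧ c1 ≠ p ∧ ∀ c, G.Adj v c → c ≠ p → c = c1) ∨
    (∃ c1 c2, c1 ≠ c2 ∧ G.Adj v c1 ∧ c1 ≠ p ∧ G.Adj v c2 ∧ c2 ≠ p ∧
      ∀ c, G.Adj v c → c ≠ p → c = c1 ∨ c = c2) := by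
  have hmem : p ∈ G.neighborSet v := hv.symm
  have h := Set.ncard_sdiff_singleton_add_one hmem (Set.toFinite _)
  set S := G.neighborSet v \ {p} with hS
  have hSm : ∀ c, c ∈ S ↔ G.Adj v c ∧ c ≠ p := by intro c; simp [hS]
  obtain h0 | h1 | h2 : S.ncard = 0 ∨ S.ncard = 1 ∨ S.ncard = 2 := by omega
  · left
    rw [Set.ncard_eq_zero (Set.toFinite _)] at h0
    intro c hc
    by_contra hne
    have := (hSm c).2 ⟨hc, hne⟩
    simp [h0] at this
  · right; left
    obtain ⟨c1, h1⟩ := Set.ncard_eq_one.1 h1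
    rw [h1] at hSm
    refine ⟨c1, ((hSm c1).1 (by simp)).1, ((hSm c1).1 (by simp)).2, fun c hc hne => ?_⟩
    simpa using (hSm c).2 ⟨hc, hne⟩
  · right; right
    obtain ⟨c1, c2, hne, h2⟩ := Set.ncard_eq_two.1 h2
    rw [h2] at hSm
    refine ⟨c1, c2, hne, ((hSm c1).1 (by simp)).1, ((hSm c1).1 (by simp)).2,
      ((hSm c2).1 (by simp)).1, ((hSm c2).1 (by simp)).2, fun c hc hne => ?_⟩
    simpa using (hSm c).2 ⟨hc, hne⟩

lemma exists_good [Finite V] (hT : G.IsTree) (hdeg : ∀ v : V, (G.neighborSet v).ncard ≤ 3)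
    (D : V → ℕ) : ∀ n p v, G.Adj p v → (br G p v).ncard ≤ n →
    (∀ w ∈ br G p v, D w = D v + G.dist w v) → ∃ L, Good G D p v L := by
  intro n
  induction n with
  | zero =>
    intro p v hv hn _
    have : (br G p v).ncard = 0 := by omega
    rw [Set.ncard_eq_zero (Set.toFinite _)] at this
    have h := self_mem_br hv
    simp [this] at h
  | succ n ih =>
    intro p v hv hn hD
    have hrec : ∀ c, G.Adj v c → c ≠ p → ∃ L, Good G D v c L ∧ Part G D p v L := by
      intro c hc hcp
      have hDc : D c = D v + 1 := by
        rw [hD c (br_sub hT hv hc hcp (self_mem_br hc)), SimpleGraph.dist_eq_one_iff_adj.2 hc.symm]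
      obtain ⟨L, hL⟩ := ih v c hc (by
        have : (br G v c).ncard < (br G p v).ncard := by
          apply Set.ncard_lt_ncard _ (Set.toFinite _)
          refine ⟨fun w hw => br_sub hT hv hc hcp hw, fun h => ?_⟩
          have := h (self_mem_br hv)
          simp [br] at this
        omega) (by
        intro w hw
        rw [hD w (br_sub hT hv hc hcp hw), hDc]
        simp only [br, Set.mem_ofPred_eq] at hw
        omega)
      exact ⟨L, hL, part_of_good hT hv hc hcp hDc hL⟩
    have cov : ∀ w ∈ br G p v, w ≠ v → ∃ c, G.Adj v c ∧ c ≠ p ∧ w ∈ br G v c := by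
      intro w hw hne
      obtain ⟨c, hc, hc'⟩ := par_exists hT hne
      refine ⟨c, hc, ?_, hc'⟩
      rintro rfl
      simp only [br, Set.mem_ofPred_eq] at hw
      omega
    rcases children hv (hdeg v) with h | ⟨c1, h1, h1p, h⟩ | ⟨c1, c2, hne, h1, h1p, h2, h2p, h⟩
    · refine combine hT hv hD (part_nil D p v) (part_nil D p v) (by simp) ?_
      intro w hw hne
      obtain ⟨c, hc, hcp, -⟩ := cov w hw hne
      exact absurd (h c hc) hcp
    · obtain ⟨L, hL, hP⟩ := hrec c1 h1 h1p
      refine combine hT hv hD hP (part_nil D p v) (by simp) ?_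
      intro w hw hne
      obtain ⟨c, hc, hcp, hwc⟩ := cov w hw hne
      rw [h c hc hcp] at hwc
      exact Or.inl ((hL.mem w).2 hwc)
    · obtain ⟨L, hL, hP⟩ := hrec c1 h1 h1p
      obtain ⟨L', hL', hP'⟩ := hrec c2 h2 h2p
      refine combine hT hv hD hP hP' ?_ ?_
      · intro u hu hu'
        rw [hL.mem] at hu
        rw [hL'.mem] at hu'
        exact hne (par_unique hT h1 h2 hu hu')
      · intro w hw hne
        obtain ⟨c, hc, hcp, hwc⟩ := cov w hw hne
        rcases h c hc hcp with rfl | rfl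
        · exact Or.inl ((hL.mem w).2 hwc)
        · exact Or.inr ((hL'.mem w).2 hwc)

lemma thin_of_list (D : V → ℕ) (k : ℕ) (hk : ∀ v, D v / 3 < k) (L : List V) (hn : L.Nodup)
    (hall : ∀ v, v ∈ L) (htri : Tri (Q G D) L) : IsKThin G k := by
  refine ⟨fun u v => [u, v].Sublist L, ?_, fun v => ⟨D v / 3, hk v⟩, ?_⟩
  · exact
      { trichotomous := by
          intro a b h1 h2
          by_contra hne
          rcases pair_total (hall a) (hall b) hne with h | h
          exacts [h1 h, h2 h]
        irrefl := fun a h => pair_ne hn h rfl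
        trans := by
          intro a b c h1 h2
          refine List.Sublist.trans ?_ (triple_of_pairs hn h1 h2)
          exact (List.sublist_cons_self b [c]).cons_cons a }
  · intro u v w h1 h2 hc
    exact htri u v w (triple_of_pairs hn h1 h2) (by simpa using hc)

lemma thin_of_edge [Finite V] (hT : G.IsTree) (hdeg : ∀ v : V, (G.neighborSet v).ncard ≤ 3)
    {a b : V} (hab : G.Adj a b) (k : ℕ) (ha : ∀ w ∈ br G b a, G.dist w a + 2 ≤ 3 * k)
    (hb : ∀ w ∈ br G a b, G.dist w b + 2 ≤ 3 * k) : IsKThin G k := by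
  classical
  let D : V → ℕ := fun w => if w ∈ br G b a then 1 + G.dist w a else 1 + G.dist w b
  have hDa' : ∀ w ∈ br G b a, D w = 1 + G.dist w a := fun w hw => if_pos hw
  have hDb' : ∀ w ∈ br G a b, D w = 1 + G.dist w b := fun w hw =>
    if_neg ((not_mem_br hT hab.symm).2 hw)
  have hDa : D a = 1 := by rw [hDa' a (self_mem_br hab.symm)]; simp
  have hDb : D b = 1 := by rw [hDb' b (self_mem_br hab)]; simp
  obtain ⟨A, hA⟩ := exists_good hT hdeg D _ b a hab.symm le_rfl
    (by intro w hw; rw [hDa, hDa' w hw])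
  obtain ⟨B, hB⟩ := exists_good hT hdeg D _ a b hab le_rfl
    (by intro w hw; rw [hDb, hDb' w hw])
  have hx : ∀ w ∈ A, w ∉ B := by
    intro w h1 h2
    rw [hA.mem] at h1
    rw [hB.mem] at h2
    exact (not_mem_br hT hab.symm).2 h2 h1
  refine thin_of_list D k ?_ (A ++ B) ?_ ?_ (tri_append hA.tri hB.tri ?_ ?_)
  · intro v
    by_cases h : v ∈ br G b a
    · have := ha v h
      rw [hDa' v h]; omega
    · rw [not_mem_br hT hab.symm] at h
      have := hb v h
      rw [hDb' v h]; omega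
  · rw [List.nodup_append]
    exact ⟨hA.nodup, hB.nodup, fun x h1 y h2 hxy => hx x h1 (hxy ▸ h2)⟩
  · intro v
    rw [List.mem_append, hA.mem, hB.mem, ← not_mem_br hT hab.symm]
    exact em _
  · intro u x w hux hw _ hadj
    have hu := (pair_mem hux).1
    rw [hA.mem] at hu
    rw [hB.mem] at hw
    obtain ⟨rfl, rfl⟩ := cross hT hab hu hw hadj
    obtain ⟨L', rfl⟩ := hA.last (by omega)
    exact absurd hux (pair_last hA.nodup)
  · intro u x w hu hxw hcol hadj
    have hne := pair_ne hB.nodup hxw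
    obtain ⟨hxB, hw⟩ := pair_mem hxw
    rw [hA.mem] at hu
    rw [hB.mem] at hw hxB
    obtain ⟨rfl, rfl⟩ := cross hT hab hu hw hadj
    have h1 := hDb' x hxB
    have h2 : 1 ≤ G.dist x w := hT.connected.pos_dist_of_ne hne
    rw [← SimpleGraph.dist_eq_one_iff_adj]
    omega

end tree

end ThinAux

theorem thinness_diameter_bound_deg3 [Fintype V] (G : SimpleGraph V) (hT : G.IsTree)
    (d : ℕ) (hd : IsGreatest {n | ∃ u v : V, G.dist u v = n} d)
    (hdeg : ∀ v : V, (G.neighborSet v).ncard ≤ 3) :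
    Thinness G ≤ (d + 8) / 6 := by
  refine Nat.sInf_le (show IsKThin G _ from ?_)
  obtain ⟨⟨u, v, huv⟩, hub⟩ := hd
  have hmax : ∀ x y, G.dist x y ≤ d := fun x y => hub ⟨x, y, rfl⟩
  rcases Nat.eq_zero_or_pos d with h0 | hpos
  · have hsub : ∀ x y : V, x = y := fun x y =>
      hT.connected.dist_eq_zero_iff.1 (by have := hmax x y; omega)
    refine ThinAux.thin_of_list (fun _ => 0) _ (fun _ => by omega) [u] (by simp)
      (fun x => by simp [hsub x u]) (ThinAux.tri_single u)
  · obtain ⟨p, hp⟩ := hT.connected.exists_walk_length_eq_dist u v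
    rw [huv] at hp
    set s := (d - 1) / 2 with hs
    have hab : G.Adj (p.getVert s) (p.getVert (s + 1)) := p.adj_getVert_succ (by omega)
    have h1 := G.dist_le (p.take s)
    have h2 := G.dist_le (p.drop (s + 1))
    rw [Walk.take_length] at h1
    rw [Walk.drop_length] at h2
    generalize p.getVert s = a at *
    generalize p.getVert (s + 1) = b at *
    have h3 := hT.connected.dist_triangle (u := u) (v := a) (w := v)
    have h4 := hT.connected.dist_triangle (u := a) (v := b) (w := v)
    have h5 := hT.connected.dist_triangle (u := u) (v := a) (w := b)
    have h6 := hT.connected.dist_triangle (u := u) (v := b) (w := v)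
    have h7 : G.dist a b = 1 := SimpleGraph.dist_eq_one_iff_adj.2 hab
    have hu : u ∈ ThinAux.br G b a := by
      simp only [ThinAux.br, Set.mem_ofPred_eq]; omega
    have hv : v ∈ ThinAux.br G a b := by
      simp only [ThinAux.br, Set.mem_ofPred_eq, G.dist_comm (u := v)]; omega
    refine ThinAux.thin_of_edge hT hdeg hab _ ?_ ?_
    · intro w hw
      obtain ⟨q, hq⟩ := hT.connected.exists_walk_length_eq_dist w v
      have h8 := ThinAux.walk_cross hT hab q hw hv
      have h9 := hmax w v
      rw [G.dist_comm (u := v)] at h8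
      omega
    · intro w hw
      obtain ⟨q, hq⟩ := hT.connected.exists_walk_length_eq_dist u w
      have h8 := ThinAux.walk_cross hT hab q hu hw
      have h9 := hmax u w
      omega
end

section
/- Let T_r be a rooted tree with thinness k, and x a critical vertex of T_r (a vertex with exactly two children that are k-neighbors of x). Then the parent of x, if it exists, is not a k-neighbor of x. -/
open SimpleGraph

variable {V : Type*}

theorem dilworth_aux {α : Type*} [PartialOrder α] (m : ℕ) : ∀ (S : Finset α) (n : ℕ), S.card = m →
    (∀ A : Finset α, A ⊆ S → (∀ u ∈ A, ∀ v ∈ A, u ≤ v → u = v) → A.card ≤ n) →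
    ∃ c : α → ℕ, (∀ v ∈ S, c v < n) ∧ ∀ u ∈ S, ∀ v ∈ S, c u = c v → u ≤ v ∨ v ≤ u := by
  classical
  induction m using Nat.strong_induction_on with
  | _ m IH =>
  intro S n hm hA
  rcases S.eq_empty_or_nonempty with rfl | hne
  · exact ⟨fun _ => 0, by simp, by simp⟩
  obtain ⟨a, ha⟩ := S.exists_maximal hne
  have haS : a ∈ S := ha.1
  have hamax : ∀ z ∈ S, a ≤ z → z = a := fun z hz h => le_antisymm (ha.2 hz h) h
  have hn : 1 ≤ n := by
    have := hA {a} (by simpa using haS) (by simp)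
    simpa using this
  -- removing a chain containing a
  have key : ∀ K : Finset α, K ⊆ S → a ∈ K → (∀ u ∈ K, ∀ v ∈ K, u ≤ v ∨ v ≤ u) →
      (∀ A : Finset α, A ⊆ S \ K → (∀ u ∈ A, ∀ v ∈ A, u ≤ v → u = v) → A.card ≤ n - 1) →
      ∃ c : α → ℕ, (∀ v ∈ S, c v < n) ∧ ∀ u ∈ S, ∀ v ∈ S, c u = c v → u ≤ v ∨ v ≤ u := by
    intro K hKS haK hK hKA
    have hlt : (S \ K).card < m := by
      rw [← hm]
      apply Finset.card_lt_card
      refine ⟨Finset.sdiff_subset, fun h => ?_⟩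
      have := h haS
      simp [haK] at this
    obtain ⟨c, hc1, hc2⟩ := IH _ hlt (S \ K) (n - 1) rfl hKA
    refine ⟨fun v => if v ∈ K then n - 1 else c v, ?_, ?_⟩
    · intro v hv
      by_cases h : v ∈ K
      · simp [h]; omega
      · have := hc1 v (by simp [hv, h])
        simp [h]; omega
    · intro u hu v hv huv
      by_cases h : u ∈ K <;> by_cases h' : v ∈ K
      · exact hK u h v h'
      · have := hc1 v (by simp [hv, h'])
        simp [h, h'] at huv; omega
      · have := hc1 u (by simp [hu, h])
        simp [h, h'] at huv; omega
      · simp [h, h'] at huv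
        exact hc2 u (by simp [hu, h]) v (by simp [hv, h']) huv
  by_cases hw : ∀ A : Finset α, A ⊆ S.erase a → (∀ u ∈ A, ∀ v ∈ A, u ≤ v → u = v) → A.card ≤ n - 1
  · refine key {a} (by simpa using haS) (by simp) (by simp) ?_
    intro A h1 h2
    exact hw A (by rwa [Finset.sdiff_singleton_eq_erase] at h1) h2
  push Not at hw
  obtain ⟨A0, hA0S, hA0, hA0c⟩ := hw
  have hsub : S.erase a ⊆ S := Finset.erase_subset _ _
  have hA0n : A0.card = n := le_antisymm (hA A0 (hA0S.trans hsub) hA0) (by omega)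
  obtain ⟨c, hc1, hc2⟩ := IH (S.erase a).card (by rw [← hm]; exact Finset.card_erase_lt_of_mem haS)
    (S.erase a) n rfl (fun A h1 h2 => hA A (h1.trans hsub) h2)
  -- good antichains meet every colour
  have hmeet : ∀ B : Finset α, B ⊆ S.erase a → (∀ u ∈ B, ∀ v ∈ B, u ≤ v → u = v) → B.card = n →
      ∀ i < n, ∃ y ∈ B, c y = i := by
    intro B hBS hB hBn i hi
    have hinj : Set.InjOn c B := by
      intro u hu v hv huv
      rcases hc2 u (hBS hu) v (hBS hv) huv with h | h
      · exact hB u hu v hv h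
      · exact (hB v hv u hu h).symm
    have himg : B.image c = Finset.range n := by
      apply Finset.eq_of_subset_of_card_le
      · intro j hj
        obtain ⟨y, hy, rfl⟩ := Finset.mem_image.1 hj
        exact Finset.mem_range.2 (hc1 y (hBS hy))
      · rw [Finset.card_image_of_injOn hinj, hBn]; simp
    have : i ∈ B.image c := by rw [himg]; simpa using hi
    simpa using this
  let Good : α → Prop := fun z => ∃ B : Finset α, B ⊆ S.erase a ∧
    (∀ u ∈ B, ∀ v ∈ B, u ≤ v → u = v) ∧ B.card = n ∧ z ∈ B
  have hx : ∀ i : Fin n, ∃ x, x ∈ S.erase a ∧ c x = i ∧ Good x ∧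
      ∀ y ∈ S.erase a, c y = i → Good y → y ≤ x := by
    intro i
    obtain ⟨y, hy, hyi⟩ := hmeet A0 hA0S hA0 hA0n i i.2
    obtain ⟨x, hx⟩ := ((S.erase a).filter (fun z => c z = i ∧ Good z)).exists_maximal
      ⟨y, Finset.mem_filter.2 ⟨hA0S hy, hyi, A0, hA0S, hA0, hA0n, hy⟩⟩
    have hx1 := Finset.mem_filter.1 hx.1
    refine ⟨x, hx1.1, hx1.2.1, hx1.2.2, ?_⟩
    intro z hz hzi hzG
    rcases hc2 z hz x hx1.1 (by rw [hzi, hx1.2.1]) with h | h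
    · exact h
    · exact hx.2 (Finset.mem_filter.2 ⟨hz, hzi, hzG⟩) h
  choose x hxS hxc hxG hxmax using hx
  have hxanti : ∀ i j, x i ≤ x j → i = j := by
    intro i j hij
    obtain ⟨B, hBS, hB, hBn, hjB⟩ := hxG j
    obtain ⟨y, hy, hyi⟩ := hmeet B hBS hB hBn i i.2
    have h1 := hxmax i y (hBS hy) hyi ⟨B, hBS, hB, hBn, hy⟩
    have h2 := hB y hy _ hjB (h1.trans hij)
    rw [h2, hxc] at hyi
    exact Fin.ext hyi.symm
  have hxinj : Function.Injective x := fun i j h => hxanti i j h.le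
  have hex : ∃ i, x i ≤ a := by
    by_contra hcon
    push Not at hcon
    have haim : a ∉ Finset.univ.image x := by
      intro h
      obtain ⟨i, _, hi⟩ := Finset.mem_image.1 h
      exact hcon i hi.le
    have := hA (insert a (Finset.univ.image x)) (by
      intro z hz
      rcases Finset.mem_insert.1 hz with rfl | hz
      · exact haS
      · obtain ⟨i, _, rfl⟩ := Finset.mem_image.1 hz
        exact hsub (hxS i)) (by
      intro u hu v hv huv
      rcases Finset.mem_insert.1 hu with rfl | hu
      · rcases Finset.mem_insert.1 hv with rfl | hv
        · rfl
        · obtain ⟨i, _, rfl⟩ := Finset.mem_image.1 hv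
          exact (hamax _ (hsub (hxS i)) huv).symm
      · obtain ⟨i, _, rfl⟩ := Finset.mem_image.1 hu
        rcases Finset.mem_insert.1 hv with rfl | hv
        · exact absurd huv (hcon i)
        · obtain ⟨j, _, rfl⟩ := Finset.mem_image.1 hv
          rw [hxanti i j huv])
    rw [Finset.card_insert_of_notMem haim, Finset.card_image_of_injective _ hxinj] at this
    simp at this
  obtain ⟨i, hi⟩ := hex
  have hKmem : ∀ z, z ∈ insert a ((S.erase a).filter (fun z => c z = i ∧ z ≤ x i)) ↔
      z = a ∨ (z ∈ S.erase a ∧ c z = i ∧ z ≤ x i) := by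
    intro z; rw [Finset.mem_insert, Finset.mem_filter]
  refine key (insert a ((S.erase a).filter (fun z => c z = i ∧ z ≤ x i))) ?_ ?_ ?_ ?_
  · intro z hz
    rcases (hKmem z).1 hz with rfl | h
    · exact haS
    · exact hsub h.1
  · simp
  · intro u hu v hv
    rcases (hKmem u).1 hu with rfl | h
    · rcases (hKmem v).1 hv with rfl | h'
      · exact Or.inl le_rfl
      · exact Or.inr (h'.2.2.trans hi)
    · rcases (hKmem v).1 hv with rfl | h'
      · exact Or.inl (h.2.2.trans hi)
      · exact hc2 u h.1 v h'.1 (by rw [h.2.1, h'.2.1])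
  · intro B hBS hB
    have hBS' : B ⊆ S.erase a := by
      intro z hz
      have h1 := Finset.mem_sdiff.1 (hBS hz)
      rw [hKmem] at h1
      exact Finset.mem_erase.2 ⟨fun h => h1.2 (Or.inl h), h1.1⟩
    have h1 := hA B (hBS'.trans hsub) hB
    by_contra hcon
    have hBn : B.card = n := by omega
    obtain ⟨y, hy, hyi⟩ := hmeet B hBS' hB hBn i i.2
    have h2 := hxmax i y (hBS' hy) hyi ⟨B, hBS', hB, hBn, hy⟩
    have h3 := Finset.mem_sdiff.1 (hBS hy)
    rw [hKmem] at h3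
    exact h3.2 (Or.inr ⟨hBS' hy, hyi, h2⟩)

theorem thin_clique {W : Type*} [Finite W] (H : SimpleGraph W) (r : W → W → Prop)
    (htri : ∀ a b, r a b ∨ a = b ∨ r b a) (htrans : ∀ a b c, r a b → r b c → r a c)
    (hirr : ∀ a, ¬ r a a) (hst : IsStrictTotalOrder W r) (k : ℕ) (hk1 : 1 ≤ k)
    (hk : k ≤ Thinness H) :
    ∃ A : Finset W, k ≤ A.card ∧ ∀ u ∈ A, ∀ v ∈ A, r u v → ∃ w, r v w ∧ H.Adj u w ∧ ¬ H.Adj v w := by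
  classical
  have := Fintype.ofFinite W
  by_contra hcon
  push Not at hcon
  let P : PartialOrder W :=
    { le := fun u v => u = v ∨ (r u v ∧ ∀ w, r v w → H.Adj u w → H.Adj v w)
      le_refl := fun u => Or.inl rfl
      le_trans := by
        rintro u v w (rfl | h1) (rfl | h2)
        · exact Or.inl rfl
        · exact Or.inr h2
        · exact Or.inr h1
        · exact Or.inr ⟨htrans _ _ _ h1.1 h2.1, fun z hz huz =>
            h2.2 z hz (h1.2 z (htrans _ _ _ h2.1 hz) huz)⟩
      le_antisymm := by
        rintro u v (rfl | h1) h
        · rfl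
        · rcases h with h | h2
          · exact h.symm
          · exact absurd (htrans _ _ _ h1.1 h2.1) (hirr _) }
  have hle : ∀ u v : W, P.le u v ↔ (u = v ∨ (r u v ∧ ∀ w, r v w → H.Adj u w → H.Adj v w)) :=
    fun _ _ => Iff.rfl
  obtain ⟨c, hc1, hc2⟩ := @dilworth_aux W P _ (Finset.univ : Finset W) (k - 1) rfl (by
    intro A _ hA
    by_contra hlt
    obtain ⟨u, hu, v, hv, huv, h⟩ := hcon A (by omega)
    have := hA u hu v hv ((hle u v).2 (Or.inr ⟨huv, h⟩))
    exact hirr v (this ▸ huv))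
  have hthin : IsKThin H (k - 1) := by
    refine ⟨r, hst, fun v => ⟨c v, hc1 v (Finset.mem_univ _)⟩, ?_⟩
    intro u v w huv hvw hC hadj
    have hC' : c u = c v := by simpa using hC
    rcases hc2 u (Finset.mem_univ _) v (Finset.mem_univ _) hC' with h | h
    · rcases (hle u v).1 h with rfl | h
      · exact hadj
      · exact h.2 w hvw hadj
    · rcases (hle v u).1 h with rfl | h
      · exact hadj
      · exact absurd (htrans _ _ _ huv h.1) (hirr _)
  have : Thinness H ≤ k - 1 := Nat.sInf_le hthin
  omega

/-- The branch hanging at `u` from the edge `v u`. -/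
def BranchSet (G : SimpleGraph V) (v u : V) : Set V :=
  ((G.deleteEdges {s(v,u)}).connectedComponentMk u).supp

theorem mem_branch (G : SimpleGraph V) (v u z : V) :
    z ∈ BranchSet G v u ↔ (G.deleteEdges {s(v,u)}).Reachable z u := by
  unfold BranchSet
  rw [SimpleGraph.ConnectedComponent.mem_supp_iff, SimpleGraph.ConnectedComponent.eq]

theorem branch_self (G : SimpleGraph V) (v u : V) : u ∈ BranchSet G v u :=
  (mem_branch G v u u).2 (SimpleGraph.Reachable.refl _)

theorem branch_not_v (G : SimpleGraph V) (hT : G.IsTree) (v u : V) (h : G.Adj v u) :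
    v ∉ BranchSet G v u := by
  intro hv
  have hb := SimpleGraph.isAcyclic_iff_forall_isBridge.1 hT.2 (e := s(v,u)) h
  rw [SimpleGraph.isBridge_iff] at hb
  exact hb ((mem_branch G v u v).1 hv)

theorem branch_closed (G : SimpleGraph V) (hT : G.IsTree) (v u : V) (h : G.Adj v u) (a b : V)
    (ha : a ∈ BranchSet G v u) (hab : G.Adj a b) (hb : b ≠ v) : b ∈ BranchSet G v u := by
  rw [mem_branch]
  have hav : a ≠ v := fun e => branch_not_v G hT v u h (e ▸ ha)
  have hadj : (G.deleteEdges {s(v,u)}).Adj b a := by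
    rw [SimpleGraph.deleteEdges_adj]
    refine ⟨hab.symm, ?_⟩
    intro hm
    rw [Set.mem_singleton_iff, Sym2.eq_iff] at hm
    rcases hm with hm | hm
    · exact hb hm.1
    · exact hav hm.2
  exact hadj.reachable.trans ((mem_branch G v u a).1 ha)

theorem branch_prop (G : SimpleGraph V) (v u : V) (P : V → Prop)
    (hP : ∀ a b, a ∈ BranchSet G v u → b ∈ BranchSet G v u → G.Adj a b → P a → P b)
    (a b : V) (ha : a ∈ BranchSet G v u) (hb : b ∈ BranchSet G v u) (hPa : P a) : P b := by
  have hr : (G.deleteEdges {s(v,u)}).Reachable a b :=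
    ((mem_branch G v u a).1 ha).trans ((mem_branch G v u b).1 hb).symm
  obtain ⟨w⟩ := hr
  induction w with
  | nil => exact hPa
  | @cons a c b hac w ih =>
    have hc : c ∈ BranchSet G v u :=
      (mem_branch G v u c).2 (hac.symm.reachable.trans ((mem_branch G v u a).1 ha))
    exact ih hc hb (hP a c ha hc (SimpleGraph.deleteEdges_adj.1 hac).1 hPa)

/-- A full clique of the incompatibility graph in a branch, with last vertex `t`. -/
theorem branch_clique [Finite V] (G : SimpleGraph V) (r : V → V → Prop)
    (hst : IsStrictTotalOrder V r)
    (htri : ∀ a b, r a b ∨ a = b ∨ r b a) (htrans : ∀ a b c, r a b → r b c → r a c)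
    (hirr : ∀ a, ¬ r a a) (k : ℕ) (hk1 : 1 ≤ k) (v u : V) (hk : k ≤ DanglingThin G v u) :
    ∃ (A : Finset V) (t : V), k ≤ A.card ∧ t ∈ A ∧ (∀ a ∈ A, a ∈ BranchSet G v u) ∧
      (∀ a ∈ A, a = t ∨ r a t) ∧
      ∀ a ∈ A, ∀ b ∈ A, r a b → ∃ w ∈ BranchSet G v u, r b w ∧ G.Adj a w ∧ ¬ G.Adj b w := by
  classical
  have hst' : IsStrictTotalOrder (BranchSet G v u) (fun a b => r a b) :=
    { trichotomous := fun a b h1 h2 => by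
        rcases htri a b with h | h | h
        · exact absurd h h1
        · exact Subtype.ext h
        · exact absurd h h2
      irrefl := fun a => hirr a
      trans := fun a b c => htrans a b c }
  obtain ⟨A, hA1, hA2⟩ := thin_clique (G.induce (BranchSet G v u)) (fun a b => r a b)
    (fun a b => by
      rcases htri a b with h | h | h
      · exact Or.inl h
      · exact Or.inr (Or.inl (Subtype.ext h))
      · exact Or.inr (Or.inr h))
    (fun a b c => htrans a b c) (fun a => hirr a) hst' k hk1 hk
  have hAne : (A.map (Function.Embedding.subtype _)).Nonempty := by
    rw [← Finset.card_pos, Finset.card_map]; omega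
  have hlast : ∀ B : Finset V, B.Nonempty → ∃ t ∈ B, ∀ a ∈ B, a = t ∨ r a t := by
    intro B hB
    induction hB using Finset.Nonempty.cons_induction with
    | singleton a => exact ⟨a, by simp, by simp⟩
    | cons a s h hs ih =>
      obtain ⟨t, ht, hmax⟩ := ih
      rcases htri a t with h1 | h1 | h1
      · refine ⟨t, by simp [ht], ?_⟩
        intro b hb
        rcases Finset.mem_cons.1 hb with rfl | hb
        · exact Or.inr h1
        · exact hmax b hb
      · exact absurd (h1 ▸ ht) h
      · refine ⟨a, by simp, ?_⟩
        intro b hb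
        rcases Finset.mem_cons.1 hb with rfl | hb
        · exact Or.inl rfl
        · rcases hmax b hb with rfl | h2
          · exact Or.inr h1
          · exact Or.inr (htrans _ _ _ h2 h1)
  obtain ⟨t, ht, hmax⟩ := hlast _ hAne
  refine ⟨A.map (Function.Embedding.subtype _), t, by simpa using hA1, ht, ?_, hmax, ?_⟩
  · intro a ha
    obtain ⟨a', _, rfl⟩ := Finset.mem_map.1 ha
    exact a'.2
  · intro a ha b hb hab
    obtain ⟨a', ha', rfl⟩ := Finset.mem_map.1 ha
    obtain ⟨b', hb', rfl⟩ := Finset.mem_map.1 hb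
    obtain ⟨w, h1, h2, h3⟩ := hA2 a' ha' b' hb' hab
    exact ⟨w, w.2, h1, h2, h3⟩

section Geometry

variable (G : SimpleGraph V) (hT : G.IsTree) (x v₁ u₁ v₂ u₂ : V)
  (hx₁ : G.Adj x v₁) (hv₁ : G.Adj v₁ u₁) (hu₁ : u₁ ≠ x)

theorem geo_x (hT : G.IsTree) (hx₁ : G.Adj x v₁) (hv₁ : G.Adj v₁ u₁) (hu₁ : u₁ ≠ x) :
    x ∉ BranchSet G v₁ u₁ := by
  intro h
  -- the first step from x to u₁ in the branch cannot avoid v₁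
  have hadj : (G.deleteEdges {s(v₁,u₁)}).Adj v₁ x := by
    rw [SimpleGraph.deleteEdges_adj]
    refine ⟨hx₁.symm, ?_⟩
    intro hm
    rw [Set.mem_singleton_iff, Sym2.eq_iff] at hm
    rcases hm with hm | hm
    · exact hu₁ hm.2.symm
    · exact hx₁.ne hm.2
  exact branch_not_v G hT v₁ u₁ hv₁
    ((mem_branch _ _ _ _).2 (hadj.reachable.trans ((mem_branch _ _ _ _).1 h)))

theorem geo_v (hT : G.IsTree) (hx₁ : G.Adj x v₁) (hv₁ : G.Adj v₁ u₁) (hu₁ : u₁ ≠ x)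
    (hx₂ : G.Adj x v₂) : v₂ ∉ BranchSet G v₁ u₁ := fun h =>
  geo_x G x v₁ u₁ hT hx₁ hv₁ hu₁ (branch_closed G hT v₁ u₁ hv₁ v₂ x h hx₂.symm hx₁.ne)

theorem geo_u (hT : G.IsTree) (hx₁ : G.Adj x v₁) (hv₁ : G.Adj v₁ u₁) (hu₁ : u₁ ≠ x)
    (hx₂ : G.Adj x v₂) (hv₂ : G.Adj v₂ u₂) (hne : v₁ ≠ v₂) : u₂ ∉ BranchSet G v₁ u₁ := fun h =>
  geo_v G x v₁ u₁ v₂ hT hx₁ hv₁ hu₁ hx₂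
    (branch_closed G hT v₁ u₁ hv₁ u₂ v₂ h hv₂.symm hne.symm)

theorem geo_disj (hT : G.IsTree) (hx₁ : G.Adj x v₁) (hv₁ : G.Adj v₁ u₁) (hu₁ : u₁ ≠ x)
    (hx₂ : G.Adj x v₂) (hv₂ : G.Adj v₂ u₂) (hu₂ : u₂ ≠ x) (hne : v₁ ≠ v₂) (a : V)
    (ha : a ∈ BranchSet G v₂ u₂) : a ∉ BranchSet G v₁ u₁ := by
  intro h
  refine geo_u G x v₁ u₁ v₂ u₂ hT hx₁ hv₁ hu₁ hx₂ hv₂ hne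
    (branch_prop G v₂ u₂ (fun z => z ∈ BranchSet G v₁ u₁) ?_ a u₂ ha (branch_self _ _ _) h)
  intro z z' _ hz' hadj hz
  refine branch_closed G hT v₁ u₁ hv₁ z z' hz hadj ?_
  rintro rfl
  exact geo_v G x v₂ u₂ z' hT hx₂ hv₂ hu₂ hx₁ hz'

end Geometry

theorem middle_contra (G : SimpleGraph V) (hT : G.IsTree) (x : V) (k : ℕ)
    (r : V → V → Prop) (C : V → Fin k) (hC : Consistent G r C)
    (htri : ∀ a b, r a b ∨ a = b ∨ r b a) (htrans : ∀ a b c, r a b → r b c → r a c)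
    (hirr : ∀ a, ¬ r a a)
    (v u v' u' v'' u'' : V)
    (hx : G.Adj x v) (hv : G.Adj v u) (hu : u ≠ x)
    (hx' : G.Adj x v') (hv' : G.Adj v' u') (hu' : u' ≠ x)
    (hx'' : G.Adj x v'') (hv'' : G.Adj v'' u'') (hu'' : u'' ≠ x)
    (hne : v ≠ v') (hne' : v ≠ v'')
    (A : Finset V) (t : V) (hk : k ≤ A.card) (ht : t ∈ A) (hAD : ∀ a ∈ A, a ∈ BranchSet G v u)
    (hmax : ∀ a ∈ A, a = t ∨ r a t)
    (hA : ∀ a ∈ A, ∀ b ∈ A, r a b → ∃ w ∈ BranchSet G v u, r b w ∧ G.Adj a w ∧ ¬ G.Adj b w)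
    (s' s'' : V) (hs' : s' ∈ BranchSet G v' u') (hs'' : s'' ∈ BranchSet G v'' u'')
    (h1 : r s' t) (h2 : r t s'') : False := by
  classical
  let S : Set V := {z | z ∈ BranchSet G v' u' ∨ z ∈ BranchSet G v'' u'' ∨ z = v' ∨ z = v'' ∨ z = x}
  have hSD : ∀ z ∈ S, z ∉ BranchSet G v u := by
    rintro z (h | h | rfl | rfl | rfl)
    · exact geo_disj G x v u v' u' hT hx hv hu hx' hv' hu' hne z h
    · exact geo_disj G x v u v'' u'' hT hx hv hu hx'' hv'' hu'' hne' z h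
    · exact geo_v G x v u _ hT hx hv hu hx'
    · exact geo_v G x v u _ hT hx hv hu hx''
    · exact geo_x G _ v u hT hx hv hu
  have hSv : ∀ z ∈ S, z ≠ v := by
    rintro z (h | h | rfl | rfl | rfl) e
    · exact geo_v G x v' u' v hT hx' hv' hu' hx (e ▸ h)
    · exact geo_v G x v'' u'' v hT hx'' hv'' hu'' hx (e ▸ h)
    · exact hne e.symm
    · exact hne' e.symm
    · exact hx.ne e
  have hnadj : ∀ z ∈ S, ∀ a ∈ BranchSet G v u, ¬ G.Adj a z := fun z hz a ha hadj =>
    hSD z hz (branch_closed G hT v u hv a z ha hadj (hSv z hz))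
  obtain ⟨y, hy, z, hz, hyz, hyt, htz⟩ : ∃ y ∈ S, ∃ z ∈ S, G.Adj y z ∧ r y t ∧ r t z := by
    by_contra hcon
    push Not at hcon
    have step : ∀ y ∈ S, ∀ z ∈ S, G.Adj y z → r y t → r z t := by
      intro y hy z hz hyz hyt
      rcases htri z t with h | h | h
      · exact h
      · exact absurd (hAD t ht) (h ▸ hSD z hz)
      · exact absurd h (hcon y hy z hz hyz hyt)
    have a1 : r u' t := branch_prop G v' u' (fun z => r z t)
      (fun a b ha hb hab => step a (Or.inl ha) b (Or.inl hb) hab) s' u' hs' (branch_self _ _ _) h1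
    have mv' : v' ∈ S := Or.inr (Or.inr (Or.inl rfl))
    have mv'' : v'' ∈ S := Or.inr (Or.inr (Or.inr (Or.inl rfl)))
    have mx : x ∈ S := Or.inr (Or.inr (Or.inr (Or.inr rfl)))
    have a2 := step u' (Or.inl (branch_self _ _ _)) v' mv' hv'.symm a1
    have a3 := step v' mv' x mx hx'.symm a2
    have a4 := step x mx v'' mv'' hx'' a3
    have a5 := step v'' mv'' u'' (Or.inr (Or.inl (branch_self _ _ _))) hv'' a4
    have a6 : r s'' t := branch_prop G v'' u'' (fun z => r z t)
      (fun a b ha hb hab => step a (Or.inr (Or.inl ha)) b (Or.inr (Or.inl hb)) hab)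
      u'' s'' (branch_self _ _ _) hs'' a5
    exact hirr _ (htrans _ _ _ a6 h2)
  have hyA : y ∉ A := fun h => hSD y hy (hAD y h)
  have hinj : Set.InjOn C (insert y A : Finset V) := by
    have hAA : ∀ a ∈ A, ∀ b ∈ A, r a b → C a ≠ C b := by
      intro a ha b hb hab e
      obtain ⟨w, _, hbw, haw, hnb⟩ := hA a ha b hb hab
      exact hnb (hC a b w hab hbw e haw)
    have hyA' : ∀ a ∈ A, C y ≠ C a := by
      intro a ha e
      rcases htri y a with h | h | h
      · have haz : r a z := by
          rcases hmax a ha with rfl | h'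
          · exact htz
          · exact htrans _ _ _ h' htz
        exact hnadj z hz a (hAD a ha) (hC y a z h haz e hyz)
      · exact hyA (h ▸ ha)
      · rcases hmax a ha with rfl | h'
        · exact hirr _ (htrans _ _ _ h hyt)
        · obtain ⟨w, hw, htw, haw, _⟩ := hA a ha t ht h'
          have := hC a y w h (htrans _ _ _ hyt htw) e.symm haw
          exact hnadj y hy w hw this.symm
    intro a ha0 b hb0 hab
    rcases Finset.mem_insert.1 ha0 with ha | ha
    · rcases Finset.mem_insert.1 hb0 with hb | hb
      · rw [ha, hb]
      · exact absurd (ha ▸ hab) (hyA' b hb)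
    · rcases Finset.mem_insert.1 hb0 with hb | hb
      · exact absurd (hb ▸ hab.symm) (hyA' a ha)
      · rcases htri a b with h | h | h
        · exact absurd hab (hAA a ha b hb h)
        · exact h
        · exact absurd hab.symm (hAA b hb a ha h)
  have := Finset.card_le_card (Finset.subset_univ ((insert y A).image C))
  rw [Finset.card_image_of_injOn hinj, Finset.card_insert_of_notMem hyA] at this
  simp at this
  omega

theorem three_contra [Fintype V] (G : SimpleGraph V) (hT : G.IsTree) (x : V) (k : ℕ)
    (hk : Thinness G = k) (v₁ v₂ v₃ : V) (h12 : v₁ ≠ v₂) (h13 : v₁ ≠ v₃) (h23 : v₂ ≠ v₃)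
    (K₁ : KNeighbor G k x v₁) (K₂ : KNeighbor G k x v₂) (K₃ : KNeighbor G k x v₃) : False := by
  classical
  have hthin : IsKThin G k := by
    have hne : {k | IsKThin G k}.Nonempty := by
      let e := Fintype.equivFin V
      refine ⟨Fintype.card V, fun a b => e a < e b, ?_, e, ?_⟩
      · exact
          { trichotomous := fun a b h1 h2 =>
              e.injective (le_antisymm (not_lt.1 h2) (not_lt.1 h1))
            irrefl := fun a => lt_irrefl _
            trans := fun a b c => lt_trans }
      · intro u v w huv _ h _
        exact absurd h huv.ne
    have := Nat.sInf_mem hne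
    rw [← hk]
    exact this
  obtain ⟨r, hst, C, hC⟩ := hthin
  have hirr : ∀ a, ¬ r a a := fun a => hst.irrefl a
  have htrans : ∀ a b c, r a b → r b c → r a c := fun a b c => hst.trans a b c
  have htri : ∀ a b, r a b ∨ a = b ∨ r b a := by
    intro a b
    by_contra h
    push Not at h
    exact h.2.1 (hst.trichotomous a b h.1 h.2.2)
  have hk1 : 1 ≤ k := by
    have := (C x).2
    omega
  obtain ⟨x1, u₁, a1, n1, d1⟩ := K₁
  obtain ⟨x2, u₂, a2, n2, d2⟩ := K₂
  obtain ⟨x3, u₃, a3, n3, d3⟩ := K₃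
  obtain ⟨A₁, t₁, c1, m1, D1, M1, I1⟩ := branch_clique G r hst htri htrans hirr k hk1 v₁ u₁ d1
  obtain ⟨A₂, t₂, c2, m2, D2, M2, I2⟩ := branch_clique G r hst htri htrans hirr k hk1 v₂ u₂ d2
  obtain ⟨A₃, t₃, c3, m3, D3, M3, I3⟩ := branch_clique G r hst htri htrans hirr k hk1 v₃ u₃ d3
  have e12 : t₁ ≠ t₂ := fun e => geo_disj G x v₁ u₁ v₂ u₂ hT x1 a1 n1 x2 a2 n2 h12 t₂ (D2 _ m2)
    (e ▸ D1 _ m1)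
  have e13 : t₁ ≠ t₃ := fun e => geo_disj G x v₁ u₁ v₃ u₃ hT x1 a1 n1 x3 a3 n3 h13 t₃ (D3 _ m3)
    (e ▸ D1 _ m1)
  have e23 : t₂ ≠ t₃ := fun e => geo_disj G x v₂ u₂ v₃ u₃ hT x2 a2 n2 x3 a3 n3 h23 t₃ (D3 _ m3)
    (e ▸ D2 _ m2)
  have mid1a := middle_contra G hT x k r C hC htri htrans hirr v₁ u₁ v₂ u₂ v₃ u₃ x1 a1 n1 x2 a2 n2
    x3 a3 n3 h12 h13 A₁ t₁ c1 m1 D1 M1 I1 t₂ t₃ (D2 _ m2) (D3 _ m3)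
  have mid1b := middle_contra G hT x k r C hC htri htrans hirr v₁ u₁ v₃ u₃ v₂ u₂ x1 a1 n1 x3 a3 n3
    x2 a2 n2 h13 h12 A₁ t₁ c1 m1 D1 M1 I1 t₃ t₂ (D3 _ m3) (D2 _ m2)
  have mid2a := middle_contra G hT x k r C hC htri htrans hirr v₂ u₂ v₁ u₁ v₃ u₃ x2 a2 n2 x1 a1 n1
    x3 a3 n3 h12.symm h23 A₂ t₂ c2 m2 D2 M2 I2 t₁ t₃ (D1 _ m1) (D3 _ m3)
  have mid2b := middle_contra G hT x k r C hC htri htrans hirr v₂ u₂ v₃ u₃ v₁ u₁ x2 a2 n2 x3 a3 n3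
    x1 a1 n1 h23 h12.symm A₂ t₂ c2 m2 D2 M2 I2 t₃ t₁ (D3 _ m3) (D1 _ m1)
  have mid3a := middle_contra G hT x k r C hC htri htrans hirr v₃ u₃ v₁ u₁ v₂ u₂ x3 a3 n3 x1 a1 n1
    x2 a2 n2 h13.symm h23.symm A₃ t₃ c3 m3 D3 M3 I3 t₁ t₂ (D1 _ m1) (D2 _ m2)
  have mid3b := middle_contra G hT x k r C hC htri htrans hirr v₃ u₃ v₂ u₂ v₁ u₁ x3 a3 n3 x2 a2 n2
    x1 a1 n1 h23.symm h13.symm A₃ t₃ c3 m3 D3 M3 I3 t₂ t₁ (D2 _ m2) (D1 _ m1)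
  have q12 : r t₁ t₂ ∨ r t₂ t₁ := (htri t₁ t₂).imp_right (fun h => h.resolve_left e12)
  have q13 : r t₁ t₃ ∨ r t₃ t₁ := (htri t₁ t₃).imp_right (fun h => h.resolve_left e13)
  have q23 : r t₂ t₃ ∨ r t₃ t₂ := (htri t₂ t₃).imp_right (fun h => h.resolve_left e23)
  rcases q12 with p | p <;> rcases q13 with q | q <;> rcases q23 with s | s
  · exact mid2a p s
  · exact mid3a q s
  · exact mid2a p s
  · exact mid1b q p
  · exact mid1a p q
  · exact mid1a p q
  · exact mid3b s q
  · exact mid2b s p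

theorem parent_of_critical_not_k_neighbor [Fintype V] (G : SimpleGraph V) (hT : G.IsTree)
    (rt x p : V) (k : ℕ) (hk : Thinness G = k)
    (hcrit : {v | IsChild G rt x v ∧ KNeighbor G k x v}.ncard = 2)
    (hp : IsChild G rt p x) :
    ¬ KNeighbor G k x p := by
  intro hK
  obtain ⟨a, b, hab, hs⟩ := Set.ncard_eq_two.1 hcrit
  have ha : a ∈ {v | IsChild G rt x v ∧ KNeighbor G k x v} := by rw [hs]; simp
  have hb : b ∈ {v | IsChild G rt x v ∧ KNeighbor G k x v} := by rw [hs]; simp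
  refine three_contra G hT x k hk a b p hab ?_ ?_ ha.2 hb.2 hK
  · rintro rfl
    have h1 := ha.1.2
    have h2 := hp.2
    omega
  · rintro rfl
    have h1 := hb.1.2
    have h2 := hp.2
    omega
end
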